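/- arXiv:1110.5169 — 2 statements merged into one kernel-verified Lean document; each statement's English description precedes it below -/
import Mathlib

section
/- For every face F of the cone P of nonnegative ternary quartics, the linear span of F in H₄ equals the linear span of the set of products {q₁·q₂ : q₁, q₂ ∈ J_F}. -/
open MvPolynomial

noncomputable section

/-- The space of ternary (3-variable) real polynomials. `H d` corresponds to the
homogeneous polynomials of degree `d` via the predicate `IsHomogeneous`. -/
abbrev MvP : Type := MvPolynomial (Fin 3) ℝ

/-- The cone `P` of nonnegative ternary quartics. -/
def Pcone : Set MvP :=
  {f | f.IsHomogeneous 4 ∧ ∀ a : Fin 3 → ℝ, 0 ≤ eval a f}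

/-- `F` is a face of the cone `P`. -/
def IsFace (F : Set MvP) : Prop :=
  F ⊆ Pcone ∧
  (∀ a ∈ F, ∀ b ∈ F, a + b ∈ F) ∧
  (∀ c : ℝ, 0 ≤ c → ∀ a ∈ F, c • a ∈ F) ∧
  (∀ a ∈ Pcone, ∀ b ∈ Pcone, a + b ∈ F → a ∈ F ∧ b ∈ F)

/-- `J_F = {q ∈ H₂ : q² ∈ F}`. -/
def Jset (F : Set MvP) : Set MvP :=
  {q | q.IsHomogeneous 2 ∧ q ^ 2 ∈ F}

/-- `φ` is the function of a ternary real form of degree `d`. -/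
def IsForm (d : ℕ) (φ : (Fin 3 → ℝ) → ℝ) : Prop :=
  ∃ p : MvP, p.IsHomogeneous d ∧ ∀ a, φ a = eval a p

/-- `φ` dominates the square of a nonzero ternary quadratic form. -/
def DominatesSq (φ : (Fin 3 → ℝ) → ℝ) : Prop :=
  ∃ ψ, IsForm 2 ψ ∧ (∃ a, ψ a ≠ 0) ∧ ∀ a, ψ a ^ 2 ≤ φ a

theorem IsForm.comp_linear {d : ℕ} {φ : (Fin 3 → ℝ) → ℝ} (h : IsForm d φ)
    (L : (Fin 3 → ℝ) →ₗ[ℝ] (Fin 3 → ℝ)) : IsForm d (fun a => φ (L a)) := by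
  obtain ⟨p, hp, hφ⟩ := h
  refine ⟨aeval (fun i => ∑ j, C (L (Pi.single j 1) i) * X j) p, ?_, fun a => ?_⟩
  · have := hp.aeval (fun i => ∑ j, C (L (Pi.single j 1) i) * X j : Fin 3 → MvP)
      (n := 1) (fun i => IsHomogeneous.sum _ _ _ fun j _ => isHomogeneous_C_mul_X _ _)
    simpa using this
  · change φ (L a) = _
    rw [hφ, ← MvPolynomial.coe_aeval_eq_eval a, ← MvPolynomial.coe_aeval_eq_eval]
    simp only [RingHom.coe_coe]
    rw [← AlgHom.comp_apply, MvPolynomial.comp_aeval]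
    congr 2
    funext i
    rw [LinearMap.pi_apply_eq_sum_univ L a]
    have hs (j : Fin 3) : (Pi.single j 1 : Fin 3 → ℝ) = fun k => if j = k then 1 else 0 := by
      ext k
      simp [Pi.single_apply, eq_comm]
    simp [hs, mul_comm]

theorem DominatesSq.of_comp {φ : (Fin 3 → ℝ) → ℝ} (e : (Fin 3 → ℝ) ≃ₗ[ℝ] (Fin 3 → ℝ))
    (h : DominatesSq (fun a => φ (e a))) : DominatesSq φ := by
  obtain ⟨ψ, hψ, ⟨a, ha⟩, hle⟩ := h
  refine ⟨fun b => ψ (e.symm b), hψ.comp_linear e.symm.toLinearMap, ⟨e a, by simpa using ha⟩,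
    fun b => ?_⟩
  simpa using hle (e.symm b)

theorem exists_linearEquiv_of_det_ne_zero (u v w : Fin 3 → ℝ)
    (h : (Matrix.of ![u, v, w]).det ≠ 0) :
    ∃ e : (Fin 3 → ℝ) ≃ₗ[ℝ] (Fin 3 → ℝ), ∀ x y z, e ![x, y, z] = x • u + y • v + z • w := by
  have hM : IsUnit (Matrix.transpose (Matrix.of ![u, v, w])).det := by
    rw [Matrix.det_transpose]; exact h.isUnit
  refine ⟨Matrix.toLinearEquiv (Pi.basisFun ℝ (Fin 3)) _ hM, fun x y z => ?_⟩
  ext i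
  simp [Matrix.toLin_eq_toLin', Matrix.toLinearEquiv, Matrix.mulVec, dotProduct, Fin.sum_univ_three]
  ring

theorem isForm_two (c₁ c₂ c₃ c₄ c₅ c₆ : ℝ) :
    IsForm 2 (fun a => c₁ * a 0 ^ 2 + c₂ * a 1 ^ 2 + c₃ * a 2 ^ 2 + c₄ * (a 0 * a 1)
      + c₅ * (a 0 * a 2) + c₆ * (a 1 * a 2)) := by
  have hX (i j : Fin 3) (c : ℝ) : (C c * (X i * X j) : MvP).IsHomogeneous 2 :=
    ((isHomogeneous_X ℝ i).mul (isHomogeneous_X ℝ j)).C_mul c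
  refine ⟨C c₁ * (X 0 * X 0) + C c₂ * (X 1 * X 1) + C c₃ * (X 2 * X 2) + C c₄ * (X 0 * X 1)
    + C c₅ * (X 0 * X 2) + C c₆ * (X 1 * X 2), ?_, fun a => ?_⟩
  · exact (((((hX _ _ _).add (hX _ _ _)).add (hX _ _ _)).add (hX _ _ _)).add (hX _ _ _)).add
      (hX _ _ _)
  · simp [pow_two]

theorem DominatesSq.of_forall {φ : (Fin 3 → ℝ) → ℝ} (c₁ c₂ c₃ c₄ c₅ c₆ k x₀ y₀ z₀ : ℝ)
    (hk : 0 < k)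
    (hne : c₁ * x₀ ^ 2 + c₂ * y₀ ^ 2 + c₃ * z₀ ^ 2 + c₄ * (x₀ * y₀) + c₅ * (x₀ * z₀)
      + c₆ * (y₀ * z₀) ≠ 0)
    (hle : ∀ x y z, k * (c₁ * x ^ 2 + c₂ * y ^ 2 + c₃ * z ^ 2 + c₄ * (x * y) + c₅ * (x * z)
      + c₆ * (y * z)) ^ 2 ≤ φ ![x, y, z]) : DominatesSq φ := by
  have hs : √k ≠ 0 := (Real.sqrt_pos.2 hk).ne'
  refine ⟨_, isForm_two (√k * c₁) (√k * c₂) (√k * c₃) (√k * c₄) (√k * c₅) (√k * c₆),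
    ⟨![x₀, y₀, z₀], ?_⟩, fun a => ?_⟩
  · have := mul_ne_zero hs hne
    simp only [Matrix.cons_val_zero, Matrix.cons_val_one, Matrix.cons_val]
    convert this using 1
    ring
  · have ha : a = ![a 0, a 1, a 2] := by ext i; fin_cases i <;> rfl
    have := hle (a 0) (a 1) (a 2)
    rw [← ha] at this
    refine le_of_eq_of_le ?_ this
    conv_rhs => rw [← Real.sq_sqrt hk.le]
    ring

theorem IsForm.exists_coeff {φ : (Fin 3 → ℝ) → ℝ} (h : IsForm 4 φ) :
    ∃ a₄₀₀ a₃₁₀ a₃₀₁ a₂₂₀ a₂₁₁ a₂₀₂ a₁₃₀ a₁₂₁ a₁₁₂ a₁₀₃ a₀₄₀ a₀₃₁ a₀₂₂ a₀₁₃ a₀₀₄ : ℝ,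
      ∀ x y z, φ ![x, y, z] =
        x ^ 4 * a₄₀₀ + x ^ 3 * (a₃₁₀ * y + a₃₀₁ * z)
        + x ^ 2 * (a₂₂₀ * y ^ 2 + a₂₁₁ * (y * z) + a₂₀₂ * z ^ 2)
        + x * (a₁₃₀ * y ^ 3 + a₁₂₁ * (y ^ 2 * z) + a₁₁₂ * (y * z ^ 2) + a₁₀₃ * z ^ 3)
        + (a₀₄₀ * y ^ 4 + a₀₃₁ * (y ^ 3 * z) + a₀₂₂ * (y ^ 2 * z ^ 2) + a₀₁₃ * (y * z ^ 3)
          + a₀₀₄ * z ^ 4) := by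
  obtain ⟨p, hp, hφ⟩ := h
  let m (t : Fin 3 → ℕ) : Fin 3 →₀ ℕ := Finsupp.equivFunOnFinite.symm t
  let c (i j k : ℕ) : ℝ := coeff (m ![i, j, k]) p
  have key (a : Fin 3 → ℝ) : eval a p = ∑ t ∈ Finset.Nat.antidiagonalTuple 3 4,
      coeff (m t) p * ∏ i, a i ^ t i := by
    rw [eval_eq']
    refine Finset.sum_of_injOn (fun d => ⇑d) DFunLike.coe_injective.injOn ?_ ?_ ?_
    · intro d hd
      rw [Finset.mem_coe, Finset.Nat.mem_antidiagonalTuple, hp.degree_eq_sum_deg_support hd]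
      exact (Finset.sum_subset (Finset.subset_univ _) fun i _ hi => by simpa using hi).symm
    · intro t _ ht
      have : coeff (m t) p = 0 := by
        by_contra hne
        exact ht ⟨m t, by simpa using hne, rfl⟩
      rw [this, zero_mul]
    · intro d _
      simp [m]
  refine ⟨c 4 0 0, c 3 1 0, c 3 0 1, c 2 2 0, c 2 1 1, c 2 0 2, c 1 3 0, c 1 2 1, c 1 1 2, c 1 0 3,
    c 0 4 0, c 0 3 1, c 0 2 2, c 0 1 3, c 0 0 4, fun x y z => ?_⟩
  rw [hφ, key]
  have : Finset.Nat.antidiagonalTuple 3 4 = {![4,0,0], ![3,1,0], ![3,0,1], ![2,2,0], ![2,1,1],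
    ![2,0,2], ![1,3,0], ![1,2,1], ![1,1,2], ![1,0,3], ![0,4,0], ![0,3,1], ![0,2,2], ![0,1,3],
    ![0,0,4]} := by decide
  rw [this]
  simp only [c]
  repeat rw [Finset.sum_insert (by decide)]
  rw [Finset.sum_singleton]
  simp only [Fin.prod_univ_three, Matrix.cons_val_zero, Matrix.cons_val_one, Matrix.cons_val]
  ring

theorem exists_pos_mul_le_of_homogeneous {E : Type*} [NormedAddCommGroup E] [NormedSpace ℝ E]
    [ProperSpace E] [Nontrivial E] {φ ψ : E → ℝ} {d : ℕ} (hd : d ≠ 0)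
    (hφ : Continuous φ) (hψ : Continuous ψ)
    (hφd : ∀ (t : ℝ) v, φ (t • v) = t ^ d * φ v) (hψd : ∀ (t : ℝ) v, ψ (t • v) = t ^ d * ψ v)
    (hpos : ∀ v, v ≠ 0 → 0 < φ v) : ∃ ε : ℝ, 0 < ε ∧ ∀ v, ε * ψ v ≤ φ v := by
  have hne : (Metric.sphere (0 : E) 1).Nonempty := NormedSpace.sphere_nonempty.2 zero_le_one
  obtain ⟨u, hu, humin⟩ := (isCompact_sphere (0 : E) 1).exists_isMinOn hne hφ.continuousOn
  obtain ⟨w, hw, hwmax⟩ := (isCompact_sphere (0 : E) 1).exists_isMaxOn hne hψ.continuousOn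
  have hu0 : 0 < φ u := hpos u (by rintro rfl; simp at hu)
  have hM : 0 < |ψ w| + 1 := by positivity
  refine ⟨φ u / (|ψ w| + 1), by positivity, fun v => ?_⟩
  rcases eq_or_ne v 0 with rfl | hv
  · have h₁ := hφd 0 0
    have h₂ := hψd 0 0
    simp [hd] at h₁ h₂
    simp [h₁, h₂]
  have hn : 0 < ‖v‖ := norm_pos_iff.2 hv
  have hs : ‖v‖⁻¹ • v ∈ Metric.sphere (0 : E) 1 := by
    simp [norm_smul, hn.ne']
  have h₁ : φ u ≤ φ (‖v‖⁻¹ • v) := humin hs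
  have h₂ : ψ (‖v‖⁻¹ • v) ≤ ψ w := hwmax hs
  have hv' : v = ‖v‖ • (‖v‖⁻¹ • v) := by simp [smul_smul, hn.ne']
  rw [hv', hφd, hψd, mul_left_comm]
  refine mul_le_mul_of_nonneg_left ?_ (by positivity)
  refine le_trans ?_ h₁
  rw [div_mul_eq_mul_div, div_le_iff₀ hM]
  exact mul_le_mul_of_nonneg_left (by linarith [le_abs_self (ψ w)]) hu0.le

theorem eq_zero_of_forall_nonneg_quartic {c₁ c₂ c₃ c₄ : ℝ}
    (h : ∀ t : ℝ, 0 ≤ c₁ * t + c₂ * t ^ 2 + c₃ * t ^ 3 + c₄ * t ^ 4) : c₁ = 0 := by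
  have hd : HasDerivAt (fun t : ℝ => c₁ * t + c₂ * t ^ 2 + c₃ * t ^ 3 + c₄ * t ^ 4) c₁ 0 := by
    have := ((((hasDerivAt_id (0 : ℝ)).const_mul c₁).add ((hasDerivAt_pow 2 (0 : ℝ)).const_mul c₂)).add
      ((hasDerivAt_pow 3 (0 : ℝ)).const_mul c₃)).add ((hasDerivAt_pow 4 (0 : ℝ)).const_mul c₄)
    refine (this.congr_of_eventuallyEq (.of_eq rfl)).congr_deriv ?_
    simp
  refine IsLocalMin.hasDerivAt_eq_zero (Filter.Eventually.of_forall fun t => ?_) hd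
  simpa using h t

theorem eq_zero_of_forall_nonneg_affine {c d : ℝ} (h : ∀ t : ℝ, 0 ≤ c * t + d) : c = 0 := by
  by_contra hc
  have := h (-(d + 1) / c)
  rw [mul_div_cancel₀ _ hc] at this
  linarith

theorem discrim_nonpos_and_leading_nonneg {A B C : ℝ} (h : ∀ t : ℝ, 0 ≤ t ^ 2 * A + t * B + C) :
    B ^ 2 ≤ 4 * A * C ∧ 0 ≤ A := by
  have hdis : B ^ 2 ≤ 4 * A * C := by
    have : discrim A B C ≤ 0 := discrim_le_zero fun t => by
      have := h t
      linarith
    rw [discrim] at this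
    linarith
  refine ⟨hdis, ?_⟩
  have hC : 0 ≤ C := by simpa using h 0
  rcases hC.eq_or_lt with hC | hC
  · rw [← hC] at hdis
    have hB : B = 0 := by nlinarith
    simpa [hB, ← hC] using h 1
  · by_contra hA
    nlinarith [sq_nonneg B, mul_pos_of_neg_of_neg (not_le.1 hA) (neg_neg_of_pos hC)]

theorem nonneg_of_forall_ne_zero {R : ℝ → ℝ} (hR : Continuous R) (h : ∀ t, t ≠ 0 → 0 ≤ R t) (t : ℝ) :
    0 ≤ R t := by
  have hc : IsClosed {t | 0 ≤ R t} := isClosed_le continuous_const hR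
  have hd : Dense {t : ℝ | t ≠ 0} := dense_compl_singleton 0
  exact hc.closure_subset_iff.2 h (hd t)

theorem IsForm.pos_quartic_dominatesSq {φ : (Fin 3 → ℝ) → ℝ} (hφ : IsForm 4 φ)
    (hpos : ∀ a, a ≠ 0 → 0 < φ a) : DominatesSq φ := by
  obtain ⟨ε, hε, hle⟩ := exists_pos_mul_le_of_homogeneous (d := 4) (φ := φ)
    (ψ := fun a => (a 0 ^ 2 + a 1 ^ 2 + a 2 ^ 2) ^ 2) (by norm_num)
    (by
      obtain ⟨p, -, hp⟩ := hφ
      rw [funext hp]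
      exact MvPolynomial.continuous_eval p)
    (by fun_prop)
    (by
      obtain ⟨p, hp, hp'⟩ := hφ
      intro t v
      rw [hp', hp', MvPolynomial.eval_eq', MvPolynomial.eval_eq', Finset.mul_sum]
      refine Finset.sum_congr rfl fun d hd => ?_
      have : ∑ i, d i = 4 := by
        rw [hp.degree_eq_sum_deg_support hd]
        exact (Finset.sum_subset (Finset.subset_univ _) fun i _ hi => by simpa using hi).symm
      simp only [Pi.smul_apply, smul_eq_mul, mul_pow, Finset.prod_mul_distrib,
        Finset.prod_pow_eq_pow_sum, this]
      ring)
    (by intro t v; simp only [Pi.smul_apply, smul_eq_mul]; ring)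
    hpos
  refine .of_forall 1 1 1 0 0 0 ε 1 0 0 hε (by norm_num) fun x y z => ?_
  have := hle ![x, y, z]
  simp only [Matrix.cons_val_zero, Matrix.cons_val_one, Matrix.cons_val] at this
  refine le_of_eq_of_le ?_ this
  ring

/-- A nonzero nonnegative quartic not involving `x` dominates a square, provided it vanishes
at `(0, 1, 0)`. -/
theorem dominatesSq_of_binary_of_zero {φ : (Fin 3 → ℝ) → ℝ} {a b c d e : ℝ}
    (h : ∀ x y z, φ ![x, y, z] =
      a * y ^ 4 + b * (y ^ 3 * z) + c * (y ^ 2 * z ^ 2) + d * (y * z ^ 3) + e * z ^ 4)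
    (hnn : ∀ v, 0 ≤ φ v) (hne : ∃ v, φ v ≠ 0) (hz : φ ![0, 1, 0] = 0) : DominatesSq φ := by
  have ha : a = 0 := by rw [h] at hz; linarith
  have hb : b = 0 := by
    refine eq_zero_of_forall_nonneg_quartic (c₂ := c) (c₃ := d) (c₄ := e) fun t => ?_
    have := hnn ![0, 1, t]
    rw [h, ha] at this
    linarith
  subst ha hb
  have hk (t : ℝ) : 0 ≤ t ^ 2 * c + t * d + e := by
    have := hnn ![0, t, 1]
    rw [h] at this
    linarith
  obtain ⟨hdis, hc⟩ := discrim_nonpos_and_leading_nonneg hk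
  rcases hc.eq_or_lt with hc | hc
  · subst hc
    have hd : d = 0 := by nlinarith
    subst hd
    have he : 0 ≤ e := by simpa using hk 0
    have he' : e ≠ 0 := by
      rintro rfl
      obtain ⟨v, hv⟩ := hne
      have hv' : v = ![v 0, v 1, v 2] := by ext i; fin_cases i <;> rfl
      rw [hv', h] at hv
      exact hv (by ring)
    refine .of_forall 0 0 1 0 0 0 e 0 0 1 (he.lt_of_ne' he') (by norm_num) fun x y z => ?_
    rw [h]
    exact le_of_eq (by ring)
  · refine .of_forall 0 0 d 0 0 (2 * c) (1 / (4 * c)) 0 ((1 - d) / (2 * c)) 1 (by positivity) ?_ fun x y z => ?_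
    · field_simp
      ring_nf
      positivity
    · rw [h, div_mul_eq_mul_div, one_mul, div_le_iff₀ (by positivity)]
      nlinarith [mul_nonneg (sub_nonneg.2 hdis) (by positivity : 0 ≤ z ^ 4)]

theorem dominatesSq_of_binary {φ : (Fin 3 → ℝ) → ℝ} {a b c d e : ℝ}
    (h : ∀ x y z, φ ![x, y, z] =
      a * y ^ 4 + b * (y ^ 3 * z) + c * (y ^ 2 * z ^ 2) + d * (y * z ^ 3) + e * z ^ 4)
    (hnn : ∀ v, 0 ≤ φ v) (hne : ∃ v, φ v ≠ 0) : DominatesSq φ := by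
  by_cases hz : ∃ v : ℝ × ℝ, v ≠ 0 ∧ φ ![0, v.1, v.2] = 0
  · obtain ⟨⟨s, t⟩, hv, hz⟩ := hz
    have hst : 0 < s ^ 2 + t ^ 2 := by
      by_contra hcon
      have hs : s = 0 := by nlinarith [sq_nonneg s, sq_nonneg t]
      have ht : t = 0 := by nlinarith [sq_nonneg s, sq_nonneg t]
      exact hv (by simp [hs, ht])
    obtain ⟨f, hf⟩ := exists_linearEquiv_of_det_ne_zero ![1, 0, 0] ![0, s, t] ![0, -t, s] (by
      rw [Matrix.det_fin_three]
      simp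
      nlinarith)
    have hf' (x y z : ℝ) : f ![x, y, z] = ![x, y * s - z * t, y * t + z * s] := by
      rw [hf]
      ext i
      fin_cases i <;> simp
      ring
    refine .of_comp f ?_
    refine dominatesSq_of_binary_of_zero
      (a := a * s ^ 4 + b * s ^ 3 * t + c * s ^ 2 * t ^ 2 + d * s * t ^ 3 + e * t ^ 4)
      (b := -4 * a * s ^ 3 * t + b * (s ^ 4 - 3 * s ^ 2 * t ^ 2) + c * (2 * s ^ 3 * t - 2 * s * t ^ 3)
        + d * (3 * s ^ 2 * t ^ 2 - t ^ 4) + 4 * e * s * t ^ 3)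
      (c := 6 * a * s ^ 2 * t ^ 2 + b * (3 * s * t ^ 3 - 3 * s ^ 3 * t)
        + c * (s ^ 4 - 4 * s ^ 2 * t ^ 2 + t ^ 4) + d * (3 * s ^ 3 * t - 3 * s * t ^ 3)
        + 6 * e * s ^ 2 * t ^ 2)
      (d := -4 * a * s * t ^ 3 + b * (3 * s ^ 2 * t ^ 2 - t ^ 4)
        + c * (2 * s * t ^ 3 - 2 * s ^ 3 * t) + d * (s ^ 4 - 3 * s ^ 2 * t ^ 2) + 4 * e * s ^ 3 * t)
      (e := a * t ^ 4 - b * s * t ^ 3 + c * s ^ 2 * t ^ 2 - d * s ^ 3 * t + e * s ^ 4)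
      (fun x y z => ?_) (fun v => hnn _) ?_ ?_
    · rw [hf', h]
      ring
    · obtain ⟨v, hv⟩ := hne
      exact ⟨f.symm v, by simpa using hv⟩
    · rw [hf']
      simpa using hz
  · push Not at hz
    obtain ⟨ε, hε, hle⟩ := exists_pos_mul_le_of_homogeneous (E := ℝ × ℝ) (d := 4)
      (φ := fun v => φ ![0, v.1, v.2])
      (ψ := fun v => (v.1 ^ 2 + v.2 ^ 2) ^ 2) (by norm_num)
      (by simp only [h]; fun_prop) (by fun_prop)
      (by intro t v; simp only [h, Prod.smul_fst, Prod.smul_snd, smul_eq_mul]; ring)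
      (by intro t v; simp only [Prod.smul_fst, Prod.smul_snd, smul_eq_mul]; ring)
      (fun v hv => (hnn _).lt_of_ne' (hz v hv))
    refine .of_forall 0 1 1 0 0 0 ε 0 1 0 hε (by norm_num) fun x y z => ?_
    have := hle (y, z)
    simp only [h] at this ⊢
    refine le_of_eq_of_le ?_ this
    ring

/-- A nonzero nonnegative quartic whose Hessian at `(1, 0, 0)` has the null vector `(0, 0, 1)`. -/
theorem dominatesSq_of_degenerate_aux {φ : (Fin 3 → ℝ) → ℝ} (hφ : IsForm 4 φ)
    (hnn : ∀ v, 0 ≤ φ v) (hne : ∃ v, φ v ≠ 0) {c d : ℝ}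
    (hcd : ∀ x z, φ ![x, 0, z] = x * z ^ 3 * c + z ^ 4 * d) : DominatesSq φ := by
  obtain ⟨a₄₀₀, a₃₁₀, a₃₀₁, a₂₂₀, a₂₁₁, a₂₀₂, a₁₃₀, a₁₂₁, a₁₁₂, a₁₀₃, a₀₄₀, a₀₃₁, a₀₂₂, a₀₁₃,
    a₀₀₄, h⟩ := hφ.exists_coeff
  have hc : c = 0 := eq_zero_of_forall_nonneg_affine (d := d) fun t => by
    have := hnn ![t, 0, 1]
    rw [hcd] at this
    linarith
  subst hc
  simp only [h] at hcd
  have e₀ := hcd 1 0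
  have e₁ := hcd 1 1
  have e₂ := hcd 1 (-1)
  have e₃ := hcd 1 2
  have e₄ := hcd 0 1
  norm_num at e₀ e₁ e₂ e₃ e₄
  obtain rfl : a₄₀₀ = 0 := by linarith
  obtain rfl : a₂₀₂ = 0 := by linarith
  obtain rfl : a₃₀₁ = 0 := by linarith
  obtain rfl : a₁₀₃ = 0 := by linarith
  obtain rfl : a₃₁₀ = 0 := by
    refine eq_zero_of_forall_nonneg_quartic (c₂ := a₂₂₀) (c₃ := a₁₃₀) (c₄ := a₀₄₀) fun t => ?_
    have := hnn ![1, t, 0]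
    rw [h] at this
    linarith
  have hquad (y z x : ℝ) := h x y z ▸ hnn ![x, y, z]
  have hq (t : ℝ) : 0 ≤ a₂₁₁ * t + a₂₂₀ :=
    (discrim_nonpos_and_leading_nonneg (A := a₂₁₁ * t + a₂₂₀)
      (B := a₁₃₀ + a₁₂₁ * t + a₁₁₂ * t ^ 2)
      (C := a₀₄₀ + a₀₃₁ * t + a₀₂₂ * t ^ 2 + a₀₁₃ * t ^ 3 + a₀₀₄ * t ^ 4) fun x => by
        linarith [hquad 1 t x]).2
  obtain rfl : a₂₁₁ = 0 := eq_zero_of_forall_nonneg_affine hq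
  have ha : 0 ≤ a₂₂₀ := by simpa using hq 0
  have hdis (z y : ℝ) : 0 ≤ 4 * a₂₂₀ * (a₀₄₀ * y ^ 4 + a₀₃₁ * (y ^ 3 * z) + a₀₂₂ * (y ^ 2 * z ^ 2)
      + a₀₁₃ * (y * z ^ 3) + a₀₀₄ * z ^ 4) - (a₁₃₀ * y ^ 2 + a₁₂₁ * (y * z) + a₁₁₂ * z ^ 2) ^ 2 := by
    refine nonneg_of_forall_ne_zero (R := fun y => 4 * a₂₂₀ * (a₀₄₀ * y ^ 4 + a₀₃₁ * (y ^ 3 * z)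
      + a₀₂₂ * (y ^ 2 * z ^ 2) + a₀₁₃ * (y * z ^ 3) + a₀₀₄ * z ^ 4)
      - (a₁₃₀ * y ^ 2 + a₁₂₁ * (y * z) + a₁₁₂ * z ^ 2) ^ 2) (by fun_prop) (fun y hy => ?_) y
    have := (discrim_nonpos_and_leading_nonneg (A := a₂₂₀ * y ^ 2)
      (B := y * (a₁₃₀ * y ^ 2 + a₁₂₁ * (y * z) + a₁₁₂ * z ^ 2))
      (C := a₀₄₀ * y ^ 4 + a₀₃₁ * (y ^ 3 * z) + a₀₂₂ * (y ^ 2 * z ^ 2)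
      + a₀₁₃ * (y * z ^ 3) + a₀₀₄ * z ^ 4) fun x => by linarith [hquad y z x]).1
    refine nonneg_of_mul_nonneg_right (a := y ^ 2) ?_ (by positivity)
    linarith
  rcases ha.eq_or_lt with rfl | ha
  · have hg (y z : ℝ) : a₁₃₀ * y ^ 2 + a₁₂₁ * (y * z) + a₁₁₂ * z ^ 2 = 0 := by
      nlinarith [hdis z y]
    have f₁ := hg 1 0
    have f₂ := hg 0 1
    have f₃ := hg 1 1
    norm_num at f₁ f₂ f₃
    subst f₁ f₂
    obtain rfl : a₁₂₁ = 0 := by linarith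
    refine dominatesSq_of_binary (a := a₀₄₀) (b := a₀₃₁) (c := a₀₂₂) (d := a₀₁₃) (e := a₀₀₄)
      (fun x y z => ?_) hnn hne
    rw [h]
    ring
  · refine .of_forall 0 a₁₃₀ a₁₁₂ (2 * a₂₂₀) 0 a₁₂₁ (1 / (4 * a₂₂₀))
      ((1 - a₁₃₀) / (2 * a₂₂₀)) 1 0 (by positivity) ?_ fun x y z => ?_
    · field_simp
      ring_nf
      positivity
    · rw [h, div_mul_eq_mul_div, one_mul, div_le_iff₀ (by positivity)]
      linarith [hdis z y]

theorem dominatesSq_of_degenerate {φ : (Fin 3 → ℝ) → ℝ} (hφ : IsForm 4 φ)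
    (hnn : ∀ v, 0 ≤ φ v) (hne : ∃ v, φ v ≠ 0) (u v w : Fin 3 → ℝ)
    (hdet : (Matrix.of ![u, v, w]).det ≠ 0) {c d : ℝ}
    (hcd : ∀ x z : ℝ, φ (x • u + z • w) = x * z ^ 3 * c + z ^ 4 * d) : DominatesSq φ := by
  obtain ⟨f, hf⟩ := exists_linearEquiv_of_det_ne_zero u v w hdet
  refine .of_comp f (dominatesSq_of_degenerate_aux (hφ.comp_linear f.toLinearMap)
    (fun _ => hnn _) ?_ (c := c) (d := d) fun x z => ?_)
  · obtain ⟨v, hv⟩ := hne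
    exact ⟨f.symm v, by simpa using hv⟩
  · rw [← hcd]
    simp [hf]

/-- At a zero `(1, 0, 0)`, either the quartic dominates a square or its Hessian is
positive definite there. -/
theorem dominatesSq_or_posDef_of_zero {φ : (Fin 3 → ℝ) → ℝ} (hφ : IsForm 4 φ)
    (hnn : ∀ v, 0 ≤ φ v) (hne : ∃ v, φ v ≠ 0) (hz : φ ![1, 0, 0] = 0) :
    DominatesSq φ ∨ ∃ a₂₂₀ a₂₁₁ a₂₀₂ a₁₃₀ a₁₂₁ a₁₁₂ a₁₀₃ a₀₄₀ a₀₃₁ a₀₂₂ a₀₁₃ a₀₀₄ : ℝ,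
      (∀ x y z, φ ![x, y, z] =
        x ^ 2 * (a₂₂₀ * y ^ 2 + a₂₁₁ * (y * z) + a₂₀₂ * z ^ 2)
        + x * (a₁₃₀ * y ^ 3 + a₁₂₁ * (y ^ 2 * z) + a₁₁₂ * (y * z ^ 2) + a₁₀₃ * z ^ 3)
        + (a₀₄₀ * y ^ 4 + a₀₃₁ * (y ^ 3 * z) + a₀₂₂ * (y ^ 2 * z ^ 2) + a₀₁₃ * (y * z ^ 3)
          + a₀₀₄ * z ^ 4)) ∧
      ∀ v : ℝ × ℝ, v ≠ 0 → 0 < a₂₂₀ * v.1 ^ 2 + a₂₁₁ * (v.1 * v.2) + a₂₀₂ * v.2 ^ 2 := by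
  obtain ⟨a₄₀₀, a₃₁₀, a₃₀₁, a₂₂₀, a₂₁₁, a₂₀₂, a₁₃₀, a₁₂₁, a₁₁₂, a₁₀₃, a₀₄₀, a₀₃₁, a₀₂₂, a₀₁₃,
    a₀₀₄, h⟩ := hφ.exists_coeff
  obtain rfl : a₄₀₀ = 0 := by
    rw [h] at hz
    linarith
  obtain rfl : a₃₁₀ = 0 := by
    refine eq_zero_of_forall_nonneg_quartic (c₂ := a₂₂₀) (c₃ := a₁₃₀) (c₄ := a₀₄₀) fun t => ?_
    have := hnn ![1, t, 0]
    rw [h] at this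
    linarith
  obtain rfl : a₃₀₁ = 0 := by
    refine eq_zero_of_forall_nonneg_quartic (c₂ := a₂₀₂) (c₃ := a₁₀₃) (c₄ := a₀₀₄) fun t => ?_
    have := hnn ![1, 0, t]
    rw [h] at this
    linarith
  have hq (v : ℝ × ℝ) : 0 ≤ a₂₂₀ * v.1 ^ 2 + a₂₁₁ * (v.1 * v.2) + a₂₀₂ * v.2 ^ 2 :=
    (discrim_nonpos_and_leading_nonneg (fun x => by
      have := hnn ![x, v.1, v.2]
      rw [h, mul_zero, zero_mul, zero_mul, add_zero, mul_zero, add_zero, zero_add] at this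
      exact this)).2
  by_cases hdeg : ∃ v : ℝ × ℝ, v ≠ 0 ∧ a₂₂₀ * v.1 ^ 2 + a₂₁₁ * (v.1 * v.2) + a₂₀₂ * v.2 ^ 2 = 0
  · left
    obtain ⟨⟨s, t⟩, hv, hst⟩ := hdeg
    refine dominatesSq_of_degenerate hφ hnn hne ![1, 0, 0] ![0, t, -s] ![0, s, t] ?_
      (c := a₁₃₀ * s ^ 3 + a₁₂₁ * (s ^ 2 * t) + a₁₁₂ * (s * t ^ 2) + a₁₀₃ * t ^ 3)
      (d := a₀₄₀ * s ^ 4 + a₀₃₁ * (s ^ 3 * t) + a₀₂₂ * (s ^ 2 * t ^ 2) + a₀₁₃ * (s * t ^ 3)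
          + a₀₀₄ * t ^ 4) fun x z => ?_
    · rw [Matrix.det_fin_three]
      simp
      intro h0
      have hs : s = 0 := by nlinarith [sq_nonneg s, sq_nonneg t]
      have ht : t = 0 := by nlinarith [sq_nonneg s, sq_nonneg t]
      exact hv (by simp [hs, ht])
    · have : x • ![1, 0, 0] + z • ![0, s, t] = ![x, z * s, z * t] := by
        ext i
        fin_cases i <;> simp
      rw [this, h]
      dsimp only at hst
      linear_combination x ^ 2 * z ^ 2 * hst
  · right
    push Not at hdeg
    refine ⟨a₂₂₀, a₂₁₁, a₂₀₂, a₁₃₀, a₁₂₁, a₁₁₂, a₁₀₃, a₀₄₀, a₀₃₁, a₀₂₂, a₀₁₃, a₀₀₄, fun x y z => ?_,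
      fun v hv => (hq v).lt_of_ne' (hdeg v hv)⟩
    rw [h]
    ring

theorem dominatesSq_of_three_zeros {φ : (Fin 3 → ℝ) → ℝ} (hφ : IsForm 4 φ)
    (hnn : ∀ v, 0 ≤ φ v) (hne : ∃ v, φ v ≠ 0) (hz₁ : φ ![1, 0, 0] = 0) (hz₂ : φ ![0, 1, 0] = 0)
    (hz₃ : φ ![0, 0, 1] = 0) : DominatesSq φ := by
  obtain hd | ⟨a₂₂₀, a₂₁₁, a₂₀₂, a₁₃₀, a₁₂₁, a₁₁₂, a₁₀₃, a₀₄₀, a₀₃₁, a₀₂₂, a₀₁₃, a₀₀₄, h, hpos⟩ :=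
    dominatesSq_or_posDef_of_zero hφ hnn hne hz₁
  · exact hd
  have ha : 0 < a₂₂₀ := by simpa using hpos (1, 0) (by simp)
  obtain rfl : a₀₄₀ = 0 := by
    rw [h] at hz₂
    linarith
  obtain rfl : a₀₀₄ = 0 := by
    rw [h] at hz₃
    linarith
  obtain rfl : a₁₃₀ = 0 := by
    refine eq_zero_of_forall_nonneg_quartic (c₂ := a₂₂₀) (c₃ := 0) (c₄ := 0) fun t => ?_
    have := hnn ![t, 1, 0]
    rw [h] at this
    linarith
  obtain rfl : a₀₃₁ = 0 := by
    refine eq_zero_of_forall_nonneg_quartic (c₂ := a₀₂₂) (c₃ := a₀₁₃) (c₄ := 0) fun t => ?_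
    have := hnn ![0, 1, t]
    rw [h] at this
    linarith
  obtain rfl : a₁₀₃ = 0 := by
    refine eq_zero_of_forall_nonneg_quartic (c₂ := a₂₀₂) (c₃ := 0) (c₄ := 0) fun t => ?_
    have := hnn ![t, 0, 1]
    rw [h] at this
    linarith
  obtain rfl : a₀₁₃ = 0 := by
    refine eq_zero_of_forall_nonneg_quartic (c₂ := a₀₂₂) (c₃ := 0) (c₄ := 0) fun t => ?_
    have := hnn ![0, t, 1]
    rw [h] at this
    linarith
  -- `φ` is a quadratic form in `(x * y, x * z, y * z)`, nonnegative on all of `ℝ³` by density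
  have hQ₀ (u v w : ℝ) (hu : u ≠ 0) (hv : v ≠ 0) (hw : w ≠ 0) :
      0 ≤ a₂₂₀ * u ^ 2 + a₂₁₁ * (u * v) + a₂₀₂ * v ^ 2 + a₁₂₁ * (u * w) + a₁₁₂ * (v * w)
        + a₀₂₂ * w ^ 2 := by
    have := hnn ![u * v, u * w, v * w]
    rw [h] at this
    refine nonneg_of_mul_nonneg_right (a := (u * v * w) ^ 2) ?_ (by positivity)
    linarith
  have hQ₁ (u v w : ℝ) (hu : u ≠ 0) (hv : v ≠ 0) :
      0 ≤ a₂₂₀ * u ^ 2 + a₂₁₁ * (u * v) + a₂₀₂ * v ^ 2 + a₁₂₁ * (u * w) + a₁₁₂ * (v * w)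
        + a₀₂₂ * w ^ 2 :=
    nonneg_of_forall_ne_zero (R := fun w => a₂₂₀ * u ^ 2 + a₂₁₁ * (u * v) + a₂₀₂ * v ^ 2
      + a₁₂₁ * (u * w) + a₁₁₂ * (v * w) + a₀₂₂ * w ^ 2) (by fun_prop)
      (fun w hw => hQ₀ u v w hu hv hw) w
  have hQ₂ (u v w : ℝ) (hu : u ≠ 0) :
      0 ≤ a₂₂₀ * u ^ 2 + a₂₁₁ * (u * v) + a₂₀₂ * v ^ 2 + a₁₂₁ * (u * w) + a₁₁₂ * (v * w)
        + a₀₂₂ * w ^ 2 :=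
    nonneg_of_forall_ne_zero (R := fun v => a₂₂₀ * u ^ 2 + a₂₁₁ * (u * v) + a₂₀₂ * v ^ 2
      + a₁₂₁ * (u * w) + a₁₁₂ * (v * w) + a₀₂₂ * w ^ 2) (by fun_prop)
      (fun v hv => hQ₁ u v w hu hv) v
  have hQ (u v w : ℝ) :
      0 ≤ a₂₂₀ * u ^ 2 + a₂₁₁ * (u * v) + a₂₀₂ * v ^ 2 + a₁₂₁ * (u * w) + a₁₁₂ * (v * w)
        + a₀₂₂ * w ^ 2 :=
    nonneg_of_forall_ne_zero (R := fun u => a₂₂₀ * u ^ 2 + a₂₁₁ * (u * v) + a₂₀₂ * v ^ 2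
      + a₁₂₁ * (u * w) + a₁₁₂ * (v * w) + a₀₂₂ * w ^ 2) (by fun_prop)
      (fun u hu => hQ₂ u v w hu) u
  refine .of_forall 0 0 0 (2 * a₂₂₀) a₂₁₁ a₁₂₁ (1 / (4 * a₂₂₀)) 1 1 0 (by positivity)
    (by simp [ha.ne']) fun x y z => ?_
  have hdis := (discrim_nonpos_and_leading_nonneg (A := a₂₂₀)
    (B := a₂₁₁ * (x * z) + a₁₂₁ * (y * z))
    (C := a₂₀₂ * (x * z) ^ 2 + a₁₁₂ * (x * z * (y * z)) + a₀₂₂ * (y * z) ^ 2)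
    fun u => by linarith [hQ u (x * z) (y * z)]).1
  rw [h, div_mul_eq_mul_div, one_mul, div_le_iff₀ (by positivity)]
  linarith

theorem dominatesSq_of_two_zeros {φ : (Fin 3 → ℝ) → ℝ} (hφ : IsForm 4 φ)
    (hnn : ∀ v, 0 ≤ φ v) (hne : ∃ v, φ v ≠ 0) (hz₁ : φ ![1, 0, 0] = 0)
    (hz₂ : φ ![0, 1, 0] = 0) : DominatesSq φ := by
  obtain hd | ⟨a₂₂₀, a₂₁₁, a₂₀₂, a₁₃₀, a₁₂₁, a₁₁₂, a₁₀₃, a₀₄₀, a₀₃₁, a₀₂₂, a₀₁₃, a₀₀₄, h, hpos⟩ :=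
    dominatesSq_or_posDef_of_zero hφ hnn hne hz₁
  · exact hd
  have ha : 0 < a₂₂₀ := by simpa using hpos (1, 0) (by simp)
  obtain rfl : a₀₄₀ = 0 := by
    rw [h] at hz₂
    linarith
  obtain rfl : a₁₃₀ = 0 := by
    refine eq_zero_of_forall_nonneg_quartic (c₂ := a₂₂₀) (c₃ := 0) (c₄ := 0) fun t => ?_
    have := hnn ![t, 1, 0]
    rw [h] at this
    linarith
  obtain rfl : a₀₃₁ = 0 := by
    refine eq_zero_of_forall_nonneg_quartic (c₂ := a₀₂₂) (c₃ := a₀₁₃) (c₄ := a₀₀₄) fun t => ?_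
    have := hnn ![0, 1, t]
    rw [h] at this
    linarith
  let q (y z : ℝ) := a₂₂₀ * y ^ 2 + a₂₁₁ * (y * z) + a₂₀₂ * z ^ 2
  let g (y z : ℝ) := a₁₂₁ * y ^ 2 + a₁₁₂ * (y * z) + a₁₀₃ * z ^ 2
  let k (y z : ℝ) := a₀₂₂ * y ^ 2 + a₀₁₃ * (y * z) + a₀₀₄ * z ^ 2
  have hqgk (x y z : ℝ) : φ ![x, y, z] = x ^ 2 * q y z + x * (z * g y z) + z ^ 2 * k y z := by
    rw [h]
    simp only [q, g, k]
    ring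
  have hqpos (y z : ℝ) (hyz : (y, z) ≠ 0) : 0 < q y z := hpos (y, z) hyz
  by_cases hz : ∃ v : ℝ × ℝ, v ≠ 0 ∧ 4 * q v.1 v.2 * k v.1 v.2 - g v.1 v.2 ^ 2 ≤ 0
  · obtain ⟨⟨b, c⟩, hv, hbc⟩ := hz
    dsimp only at hbc
    have hq := hqpos b c hv
    rcases eq_or_ne c 0 with rfl | hc
    · have hb : b ≠ 0 := by rintro rfl; simp at hv
      have hD : 4 * a₂₂₀ * a₀₂₂ - a₁₂₁ ^ 2 ≤ 0 := by
        refine nonpos_of_mul_nonpos_right (a := b ^ 4) ?_ (by positivity)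
        simp only [q, g, k] at hbc
        linarith
      have hH : 0 ≤ a₂₂₀ * (4 * a₂₂₀ * a₀₂₂ - a₁₂₁ ^ 2) :=
        (discrim_nonpos_and_leading_nonneg (B := 4 * a₂₂₀ ^ 2 * a₀₁₃ * 2 * a₂₂₀
            - a₁₂₁ * (2 * a₂₂₀) * (2 * a₂₂₀) * a₁₁₂ + a₁₂₁ ^ 2 * (2 * a₂₂₀) * a₂₁₁)
          (C := φ ![-a₁₂₁, 0, 2 * a₂₂₀]) fun y => by
            have := hnn ![-a₁₂₁, y, 2 * a₂₂₀]
            rw [h] at this ⊢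
            linarith).2
      have hH' : 4 * a₂₂₀ * a₀₂₂ - a₁₂₁ ^ 2 = 0 :=
        le_antisymm hD (nonneg_of_mul_nonneg_right hH ha)
      refine dominatesSq_of_degenerate hφ hnn hne ![0, 1, 0] ![1, 0, 0] ![-a₁₂₁, 0, 2 * a₂₂₀] ?_
        (c := 8 * a₂₂₀ ^ 3 * a₀₁₃
            - 4 * a₁₂₁ * a₂₂₀ ^ 2 * a₁₁₂ + 2 * a₁₂₁ ^ 2 * a₂₂₀ * a₂₁₁)
        (d := φ ![-a₁₂₁, 0, 2 * a₂₂₀]) fun x z => ?_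
      · rw [Matrix.det_fin_three]
        simp [ha.ne']
      · have : x • ![0, 1, 0] + z • ![-a₁₂₁, 0, 2 * a₂₂₀] = ![-(z * a₁₂₁), x, z * (2 * a₂₂₀)] := by
          ext i
          fin_cases i <;> simp
        rw [this, h, h]
        linear_combination x ^ 2 * z ^ 2 * a₂₂₀ * hH'
    · obtain ⟨f, hf⟩ := exists_linearEquiv_of_det_ne_zero ![1, 0, 0] ![0, 1, 0]
        ![-(c * g b c) / (2 * q b c), b, c] (by
          rw [Matrix.det_fin_three]
          simp [hc])
      have hzero : φ ![-(c * g b c) / (2 * q b c), b, c] = 0 := by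
        refine le_antisymm ?_ (hnn _)
        have : φ ![-(c * g b c) / (2 * q b c), b, c]
            = c ^ 2 * (4 * q b c * k b c - g b c ^ 2) / (4 * q b c) := by
          rw [hqgk]
          field_simp
          ring
        rw [this]
        exact div_nonpos_of_nonpos_of_nonneg
          (mul_nonpos_of_nonneg_of_nonpos (by positivity) hbc) (by positivity)
      refine .of_comp f (dominatesSq_of_three_zeros (hφ.comp_linear f.toLinearMap)
        (fun _ => hnn _) ?_ ?_ ?_ ?_)
      · obtain ⟨v, hv⟩ := hne
        exact ⟨f.symm v, by simpa using hv⟩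
      · simpa [hf] using hz₁
      · simpa [hf] using hz₂
      · simpa [hf] using hzero
  · push Not at hz
    obtain ⟨ε, hε, hle⟩ := exists_pos_mul_le_of_homogeneous (E := ℝ × ℝ) (d := 4)
      (φ := fun v => 4 * q v.1 v.2 * k v.1 v.2 - g v.1 v.2 ^ 2)
      (ψ := fun v => q v.1 v.2 * v.2 ^ 2) (by norm_num)
      (by simp only [q, g, k]; fun_prop) (by simp only [q]; fun_prop)
      (by intro t v; simp only [q, g, k, Prod.smul_fst, Prod.smul_snd, smul_eq_mul]; ring)
      (by intro t v; simp only [q, Prod.smul_fst, Prod.smul_snd, smul_eq_mul]; ring)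
      (fun v hv => hz v hv)
    refine .of_forall 0 0 1 0 0 0 (ε / 4) 0 0 1 (by positivity) (by norm_num) fun x y z => ?_
    by_cases hyz : (y, z) = 0
    · obtain ⟨rfl, rfl⟩ : y = 0 ∧ z = 0 := by simpa using hyz
      simpa using hnn ![x, 0, 0]
    have hq := hqpos y z hyz
    refine le_of_mul_le_mul_left (a := 4 * q y z) ?_ (by positivity)
    have := mul_le_mul_of_nonneg_left (hle (y, z)) (sq_nonneg z)
    dsimp only at this
    rw [hqgk]
    linarith [sq_nonneg (2 * x * q y z + z * g y z)]

theorem dominatesSq_of_zero {φ : (Fin 3 → ℝ) → ℝ} (hφ : IsForm 4 φ)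
    (hnn : ∀ v, 0 ≤ φ v) (hne : ∃ v, φ v ≠ 0) (hz₁ : φ ![1, 0, 0] = 0) : DominatesSq φ := by
  obtain hd | ⟨a₂₂₀, a₂₁₁, a₂₀₂, a₁₃₀, a₁₂₁, a₁₁₂, a₁₀₃, a₀₄₀, a₀₃₁, a₀₂₂, a₀₁₃, a₀₀₄, h, hpos⟩ :=
    dominatesSq_or_posDef_of_zero hφ hnn hne hz₁
  · exact hd
  let q (y z : ℝ) := a₂₂₀ * y ^ 2 + a₂₁₁ * (y * z) + a₂₀₂ * z ^ 2
  let g (y z : ℝ) := a₁₃₀ * y ^ 3 + a₁₂₁ * (y ^ 2 * z) + a₁₁₂ * (y * z ^ 2) + a₁₀₃ * z ^ 3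
  let k (y z : ℝ) := a₀₄₀ * y ^ 4 + a₀₃₁ * (y ^ 3 * z) + a₀₂₂ * (y ^ 2 * z ^ 2)
    + a₀₁₃ * (y * z ^ 3) + a₀₀₄ * z ^ 4
  have hqgk (x y z : ℝ) : φ ![x, y, z] = x ^ 2 * q y z + x * g y z + k y z := h x y z
  have hqpos (y z : ℝ) (hyz : (y, z) ≠ 0) : 0 < q y z := hpos (y, z) hyz
  by_cases hz : ∃ v : ℝ × ℝ, v ≠ 0 ∧ 4 * q v.1 v.2 * k v.1 v.2 - g v.1 v.2 ^ 2 ≤ 0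
  · obtain ⟨⟨b, c⟩, hv, hbc⟩ := hz
    dsimp only at hbc
    have hq := hqpos b c hv
    obtain ⟨f, hf⟩ := exists_linearEquiv_of_det_ne_zero ![1, 0, 0] ![-g b c / (2 * q b c), b, c]
      ![0, -c, b] (by
        rw [Matrix.det_fin_three]
        simp
        intro h0
        have hs : b = 0 := by nlinarith [sq_nonneg b, sq_nonneg c]
        have ht : c = 0 := by nlinarith [sq_nonneg b, sq_nonneg c]
        exact hv (by simp [hs, ht]))
    have hzero : φ ![-g b c / (2 * q b c), b, c] = 0 := by
      refine le_antisymm ?_ (hnn _)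
      have : φ ![-g b c / (2 * q b c), b, c] = (4 * q b c * k b c - g b c ^ 2) / (4 * q b c) := by
        rw [hqgk]
        field_simp
        ring
      rw [this]
      exact div_nonpos_of_nonpos_of_nonneg hbc (by positivity)
    refine .of_comp f (dominatesSq_of_two_zeros (hφ.comp_linear f.toLinearMap)
      (fun _ => hnn _) ?_ ?_ ?_)
    · obtain ⟨v, hv⟩ := hne
      exact ⟨f.symm v, by simpa using hv⟩
    · simpa [hf] using hz₁
    · simpa [hf] using hzero
  · push Not at hz
    obtain ⟨ε, hε, hle⟩ := exists_pos_mul_le_of_homogeneous (E := ℝ × ℝ) (d := 6)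
      (φ := fun v => 4 * q v.1 v.2 * k v.1 v.2 - g v.1 v.2 ^ 2)
      (ψ := fun v => q v.1 v.2 ^ 3) (by norm_num)
      (by simp only [q, g, k]; fun_prop) (by simp only [q]; fun_prop)
      (by intro t v; simp only [q, g, k, Prod.smul_fst, Prod.smul_snd, smul_eq_mul]; ring)
      (by intro t v; simp only [q, Prod.smul_fst, Prod.smul_snd, smul_eq_mul]; ring)
      (fun v hv => hz v hv)
    refine .of_forall 0 a₂₂₀ a₂₀₂ 0 0 a₂₁₁ (ε / 4) 0 1 0 (by positivity)
      (by simpa [q] using (hqpos 1 0 (by simp)).ne') fun x y z => ?_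
    have hqe : 0 * x ^ 2 + a₂₂₀ * y ^ 2 + a₂₀₂ * z ^ 2 + 0 * (x * y) + 0 * (x * z) + a₂₁₁ * (y * z)
        = q y z := by simp only [q]; ring
    rw [hqe]
    by_cases hyz : (y, z) = 0
    · obtain ⟨rfl, rfl⟩ : y = 0 ∧ z = 0 := by simpa using hyz
      simpa [q] using hnn ![x, 0, 0]
    have hq := hqpos y z hyz
    refine le_of_mul_le_mul_left (a := 4 * q y z) ?_ (by positivity)
    have := hle (y, z)
    dsimp only at this
    rw [hqgk]
    linarith [sq_nonneg (2 * x * q y z + g y z)]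

theorem IsForm.dominatesSq {φ : (Fin 3 → ℝ) → ℝ} (hφ : IsForm 4 φ)
    (hnn : ∀ v, 0 ≤ φ v) (hne : ∃ v, φ v ≠ 0) : DominatesSq φ := by
  by_cases hz : ∃ v, v ≠ 0 ∧ φ v = 0
  · obtain ⟨v, hv, hz⟩ := hz
    obtain ⟨u, w, hdet⟩ : ∃ u w, (Matrix.of ![v, u, w]).det ≠ 0 := by
      obtain ⟨i, hi⟩ := Function.ne_iff.1 hv
      fin_cases i
      · refine ⟨![0, 1, 0], ![0, 0, 1], ?_⟩
        rw [Matrix.det_fin_three]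
        simpa using hi
      · refine ⟨![1, 0, 0], ![0, 0, 1], ?_⟩
        rw [Matrix.det_fin_three]
        simpa using hi
      · refine ⟨![1, 0, 0], ![0, 1, 0], ?_⟩
        rw [Matrix.det_fin_three]
        simpa using hi
    obtain ⟨f, hf⟩ := exists_linearEquiv_of_det_ne_zero v u w hdet
    refine .of_comp f (dominatesSq_of_zero (hφ.comp_linear f.toLinearMap) (fun _ => hnn _) ?_ ?_)
    · obtain ⟨v, hv⟩ := hne
      exact ⟨f.symm v, by simpa using hv⟩
    · simpa [hf] using hz
  · push Not at hz
    exact hφ.pos_quartic_dominatesSq fun v hv => (hnn v).lt_of_ne' (hz v hv)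

theorem exists_sub_sq_mem_Pcone {f : MvP} (hf : f ∈ Pcone) (hf0 : f ≠ 0) :
    ∃ q : MvP, q.IsHomogeneous 2 ∧ q ≠ 0 ∧ f - q ^ 2 ∈ Pcone := by
  have hne : ∃ v, eval v f ≠ 0 := by
    by_contra! h
    exact hf0 (MvPolynomial.funext fun v => by simp [h v])
  obtain ⟨ψ, ⟨q, hq, hψ⟩, ⟨a, ha⟩, hle⟩ :=
    IsForm.dominatesSq (φ := fun v => eval v f) ⟨f, hf.1, fun _ => rfl⟩ hf.2 hne
  refine ⟨q, hq, ?_, hf.1.sub (hq.pow 2), fun v => ?_⟩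
  · rintro rfl
    exact ha (by simp [hψ])
  · have := hle v
    rw [hψ] at this
    simpa using this

/-- The quartic forms bounded in absolute value by a multiple of `f`. -/
def dominatedSubmodule (f : MvP) : Submodule ℝ MvP where
  carrier := {g | g.IsHomogeneous 4 ∧ ∃ K : ℝ, ∀ a, |eval a g| ≤ K * eval a f}
  add_mem' := by
    rintro g₁ g₂ ⟨h₁, K₁, hK₁⟩ ⟨h₂, K₂, hK₂⟩
    refine ⟨h₁.add h₂, K₁ + K₂, fun a => ?_⟩
    rw [map_add, add_mul]
    exact (abs_add_le _ _).trans (add_le_add (hK₁ a) (hK₂ a))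
  zero_mem' := ⟨isHomogeneous_zero _ _ _, 0, fun a => by simp⟩
  smul_mem' := by
    rintro c g ⟨h, K, hK⟩
    refine ⟨(homogeneousSubmodule (Fin 3) ℝ 4).smul_mem c h, |c| * K, fun a => ?_⟩
    rw [smul_eval, abs_mul, mul_assoc]
    exact mul_le_mul_of_nonneg_left (hK a) (abs_nonneg c)

theorem finiteDimensional_dominatedSubmodule (f : MvP) :
    FiniteDimensional ℝ (dominatedSubmodule f) := by
  have : FiniteDimensional ℝ (homogeneousSubmodule (Fin 3) ℝ 4) :=
    Module.Finite.iff_fg.2 (homogeneousSubmodule_fg (Fin 3) ℝ 4)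
  exact Submodule.finiteDimensional_of_le
    (show dominatedSubmodule f ≤ homogeneousSubmodule (Fin 3) ℝ 4 from fun g hg => hg.1)

/-- One can subtract a square from a nonzero nonnegative quartic so that the face it generates
becomes smaller. -/
theorem exists_sub_sq_dominatedSubmodule_lt {f : MvP} (hf : f ∈ Pcone) (hf0 : f ≠ 0) :
    ∃ q : MvP, q.IsHomogeneous 2 ∧ f - q ^ 2 ∈ Pcone ∧
      dominatedSubmodule (f - q ^ 2) < dominatedSubmodule f := by
  obtain ⟨q, hq, hq0, hfq⟩ := exists_sub_sq_mem_Pcone hf hf0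
  obtain ⟨a₀, ha₀⟩ : ∃ v, eval v q ≠ 0 := by
    by_contra! h
    exact hq0 (MvPolynomial.funext fun v => by simp [h v])
  have hle (a : Fin 3 → ℝ) : eval a q ^ 2 ≤ eval a f := by simpa using hfq.2 a
  let T : Set ℝ := {t | ∀ a, t * eval a q ^ 2 ≤ eval a f}
  have h1T : (1 : ℝ) ∈ T := fun a => by simpa using hle a
  have hbound (a : Fin 3 → ℝ) (ha : eval a q ≠ 0) (t : ℝ) (ht : t ∈ T) :
      t ≤ eval a f / eval a q ^ 2 := by
    rw [le_div_iff₀ (by positivity)]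
    exact ht a
  have hT : BddAbove T := ⟨_, hbound a₀ ha₀⟩
  have h1s : 1 ≤ sSup T := le_csSup hT h1T
  have hs0 : 0 ≤ sSup T := zero_le_one.trans h1s
  have hsT : sSup T ∈ T := fun a => by
    rcases eq_or_ne (eval a q) 0 with ha | ha
    · simpa [ha] using hf.2 a
    · rw [← le_div_iff₀ (by positivity)]
      exact csSup_le ⟨1, h1T⟩ (hbound a ha)
  have heval (a : Fin 3 → ℝ) :
      eval a (f - (C √(sSup T) * q) ^ 2) = eval a f - sSup T * eval a q ^ 2 := by
    simp [mul_pow, Real.sq_sqrt hs0]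
  have hq' : (C √(sSup T) * q).IsHomogeneous 2 := hq.C_mul _
  have hmem : f - (C √(sSup T) * q) ^ 2 ∈ Pcone :=
    ⟨hf.1.sub (hq'.pow 2), fun a => by rw [heval]; linarith [hsT a]⟩
  refine ⟨_, hq', hmem, lt_of_le_of_ne ?_ fun heq => ?_⟩
  · rintro g ⟨hg, K, hK⟩
    refine ⟨hg, |K|, fun a => (hK a).trans ?_⟩
    refine mul_le_mul (le_abs_self K) ?_ (hmem.2 a) (abs_nonneg K)
    rw [heval]
    nlinarith [mul_nonneg hs0 (sq_nonneg (eval a q))]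
  · have hin : q ^ 2 ∈ dominatedSubmodule f :=
      ⟨hq.pow 2, 1, fun a => by simpa using hle a⟩
    rw [← heq] at hin
    obtain ⟨-, K, hK⟩ := hin
    have hpos : 0 < |K| + 1 := by positivity
    have : sSup T + 1 / (|K| + 1) ∈ T := fun a => by
      have h₁ := hK a
      have h₂ := hmem.2 a
      rw [heval] at h₁ h₂
      rw [map_pow, abs_of_nonneg (sq_nonneg _)] at h₁
      have h₃ : eval a q ^ 2 ≤ (|K| + 1) * (eval a f - sSup T * eval a q ^ 2) :=
        h₁.trans (mul_le_mul_of_nonneg_right (by linarith [le_abs_self K]) h₂)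
      have h₄ : 1 / (|K| + 1) * eval a q ^ 2 ≤ eval a f - sSup T * eval a q ^ 2 := by
        rw [div_mul_eq_mul_div, one_mul, div_le_iff₀ hpos]
        linarith
      linarith
    have h₅ := le_csSup hT this
    have : 0 < 1 / (|K| + 1) := by positivity
    linarith

/-- **Hilbert's theorem**: nonnegative ternary quartics are sums of squares of quadratic forms. -/
theorem mem_closure_sq_of_mem_Pcone {f : MvP} (hf : f ∈ Pcone) :
    f ∈ AddSubmonoid.closure {s : MvP | ∃ q : MvP, q.IsHomogeneous 2 ∧ s = q ^ 2} := by
  induction hn : Module.finrank ℝ (dominatedSubmodule f) using Nat.strong_induction_on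
    generalizing f with
  | _ n ih =>
    rcases eq_or_ne f 0 with rfl | hf0
    · exact zero_mem _
    obtain ⟨q, hq, hmem, hlt⟩ := exists_sub_sq_dominatedSubmodule_lt hf hf0
    have := finiteDimensional_dominatedSubmodule f
    have hg := ih _ (hn ▸ Submodule.finrank_lt_finrank_of_lt hlt) hmem rfl
    rw [← sub_add_cancel f (q ^ 2)]
    exact add_mem hg (AddSubmonoid.subset_closure ⟨q, hq, rfl⟩)

/-- For every face `F` of `P`, the linear span of `F` in `H₄` equals the
linear span of the set of products `{q₁ q₂ : q₁, q₂ ∈ J_F}`. -/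
theorem stmt_3 (F : Set MvP) (hF : IsFace F) :
    Submodule.span ℝ F =
      Submodule.span ℝ {h : MvP | ∃ q₁ ∈ Jset F, ∃ q₂ ∈ Jset F, h = q₁ * q₂} := by
  obtain ⟨hFP, hadd, hsmul, hface⟩ := hF
  have hsq {q : MvP} (hq : q.IsHomogeneous 2) : q ^ 2 ∈ Pcone :=
    ⟨hq.pow 2, fun a => by rw [map_pow]; positivity⟩
  apply le_antisymm
  · rw [Submodule.span_le]
    intro f hf
    have key : f ∈ Pcone ∧ (f ∈ F → f ∈ Submodule.span ℝ
        {h : MvP | ∃ q₁ ∈ Jset F, ∃ q₂ ∈ Jset F, h = q₁ * q₂}) := by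
      have hcl := mem_closure_sq_of_mem_Pcone (hFP hf)
      clear hf
      induction hcl using AddSubmonoid.closure_induction with
      | mem s hs =>
        obtain ⟨q, hq, rfl⟩ := hs
        exact ⟨hsq hq, fun h => Submodule.subset_span ⟨q, ⟨hq, h⟩, q, ⟨hq, h⟩, pow_two q⟩⟩
      | zero => exact ⟨⟨isHomogeneous_zero _ _ _, by simp⟩, fun _ => zero_mem _⟩
      | add x y _ _ hx hy =>
        refine ⟨⟨hx.1.1.add hy.1.1, fun a => ?_⟩, fun h => ?_⟩
        · rw [map_add]
          exact add_nonneg (hx.1.2 a) (hy.1.2 a)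
        · obtain ⟨hxF, hyF⟩ := hface x hx.1 y hy.1 h
          exact add_mem (hx.2 hxF) (hy.2 hyF)
    exact key.2 hf
  · rw [Submodule.span_le]
    rintro _ ⟨q₁, ⟨h₁, hq₁⟩, q₂, ⟨h₂, hq₂⟩, rfl⟩
    have hsum : (q₁ + q₂) ^ 2 + (q₁ - q₂) ^ 2 ∈ F := by
      have := hsmul 2 zero_le_two _ (hadd _ hq₁ _ hq₂)
      convert this using 1
      rw [ofNat_smul_eq_nsmul]
      ring
    obtain ⟨hp, hm⟩ := hface _ (hsq (h₁.add h₂)) _ (hsq (h₁.sub h₂)) hsum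
    have : q₁ * q₂ = (1 / 4 : ℝ) • ((q₁ + q₂) ^ 2 - (q₁ - q₂) ^ 2) := by
      rw [show (q₁ + q₂) ^ 2 - (q₁ - q₂) ^ 2 = (4 : ℝ) • (q₁ * q₂) by
        rw [ofNat_smul_eq_nsmul]
        ring, smul_smul]
      norm_num
    rw [this]
    exact Submodule.smul_mem _ _ (sub_mem (Submodule.subset_span hp) (Submodule.subset_span hm))
end
end

section
/- Let s₁,…,sₙ, p₁,…,pₘ ∈ ℝ³ \ {0} be pairwise non-proportional, and let v₁,…,vₘ ∈ ℝ³ with vⱼ not a scalar multiple of pⱼ. Set F_S := (⋂ᵢ F_{sᵢ}) ∩ (⋂ⱼ F_{(pⱼ,vⱼ)}) and I_S := (⋂ᵢ I_{sᵢ}) ∩ (⋂ⱼ I_{(pⱼ,vⱼ)}). Let J be a linear subspace of J_{F_S} := {q ∈ H₂ : q² ∈ F_S} such that: (1) every a ∈ ℝ³ \ {0} with q(a) = 0 for all q ∈ J is a scalar multiple of some sᵢ or some pⱼ; (2) for each i there exist q, q' ∈ J with ∇q(sᵢ) and ∇q'(sᵢ) linearly independent; (3) for each j there exists q ∈ J with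 ∇q(pⱼ) ≠ 0; (4) for each j, every nonzero a in the linear span of {pⱼ, vⱼ} satisfying q(a) = 0 for all q ∈ E_J(pⱼ) := {q ∈ J : ∇q(pⱼ) = 0} is a scalar multiple of pⱼ. Then span(F_S) = I_S; moreover, for any basis q₁,…,q_k of J, the form f := q₁² + ⋯ + q_k² satisfies F_f = F_S. -/
open MvPolynomial

noncomputable section

/-- The univariate polynomial `t ↦ f (p + t • v)`. -/
def lineP (p v : Fin 3 → ℝ) (f : MvP) : Polynomial ℝ :=
  MvPolynomial.aeval (fun i => Polynomial.C (p i) + Polynomial.C (v i) * Polynomial.X) f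

/-- The face `F_p = {f ∈ P : f(p) = 0}`. -/
def Fp (p : Fin 3 → ℝ) : Set MvP := {f ∈ Pcone | eval p f = 0}

/-- The face `F_{(p,v)}`: members of `P` vanishing at `p` whose restriction to the line
`t ↦ p + t v` has vanishing `t²`-coefficient. -/
def Fpv (p v : Fin 3 → ℝ) : Set MvP :=
  {f ∈ Pcone | eval p f = 0 ∧ (lineP p v f).coeff 2 = 0}

/-- The gradient `∇f(p)`. -/
def grad (f : MvP) (p : Fin 3 → ℝ) : Fin 3 → ℝ := fun i => eval p (pderiv i f)

/-- The Hessian matrix `(Hess f)(p)`. -/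
def hess (f : MvP) (p : Fin 3 → ℝ) : Matrix (Fin 3) (Fin 3) ℝ :=
  Matrix.of fun i j => eval p (pderiv i (pderiv j f))

/-- `I_p = {f ∈ H₄ : f(p) = 0, ∇f(p) = 0}`. -/
def Ip (p : Fin 3 → ℝ) : Set MvP :=
  {f | f.IsHomogeneous 4 ∧ eval p f = 0 ∧ grad f p = 0}

/-- `I_{(p,v)}`. -/
def Ipv (p v : Fin 3 → ℝ) : Set MvP :=
  {f | f.IsHomogeneous 4 ∧ eval p f = 0 ∧ grad f p = 0 ∧
    (hess f p).mulVec v = 0 ∧ (lineP p v f).coeff 3 = 0}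

/-- `F_f = {g ∈ P : f - ε g ∈ P for some ε > 0}`, the smallest face of `P`
containing `f` as an inner point. -/
def Fface (f : MvP) : Set MvP :=
  {g ∈ Pcone | ∃ ε : ℝ, 0 < ε ∧ f - ε • g ∈ Pcone}

/-- `F_S` for the configuration `S = {s₁,…,sₙ,(p₁,v₁),…,(pₘ,vₘ)}`. -/
def FS {n m : ℕ} (s : Fin n → Fin 3 → ℝ) (p v : Fin m → Fin 3 → ℝ) : Set MvP :=
  Pcone ∩ (⋂ i, Fp (s i)) ∩ ⋂ j, Fpv (p j) (v j)

/-- `I_S` for the configuration `S = {s₁,…,sₙ,(p₁,v₁),…,(pₘ,vₘ)}`. -/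
def IS {n m : ℕ} (s : Fin n → Fin 3 → ℝ) (p v : Fin m → Fin 3 → ℝ) : Set MvP :=
  {f : MvP | f.IsHomogeneous 4} ∩ (⋂ i, Ip (s i)) ∩ ⋂ j, Ipv (p j) (v j)

/-- The derivative of polynomials in the constant direction `v`. -/
def dirD (v : Fin 3 → ℝ) : Derivation ℝ MvP MvP := mkDerivation ℝ fun i => C (v i)

lemma dirD_apply (v : Fin 3 → ℝ) (f : MvP) : dirD v f = ∑ i, C (v i) * pderiv i f := by
  have h : dirD v = (C (v 0) : MvP) • pderiv 0 + (C (v 1) : MvP) • pderiv 1 +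
      (C (v 2) : MvP) • pderiv 2 := by
    refine derivation_ext fun j => ?_
    rw [dirD, mkDerivation_X]
    fin_cases j <;> simp [pderiv_X]
  rw [h, Fin.sum_univ_three]
  simp

lemma eval_dirD (p v : Fin 3 → ℝ) (f : MvP) : eval p (dirD v f) = grad f p ⬝ᵥ v := by
  simp [dirD_apply, grad, dotProduct, mul_comm]

lemma eval_dirD_dirD (p v w : Fin 3 → ℝ) (f : MvP) :
    eval p (dirD w (dirD v f)) = w ⬝ᵥ (hess f p).mulVec v := by
  simp only [dirD_apply, hess, dotProduct, Matrix.mulVec, Matrix.of_apply, Derivation.leibniz,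
    map_add, map_mul, pderiv_C, eval_C, smul_eq_mul, Fin.sum_univ_three, map_zero]
  ring

lemma isHomogeneous_one_expansion {l : MvP} (hl : l ∈ homogeneousSubmodule (Fin 3) ℝ 1) :
    (∀ a b c : Fin 3 → ℝ, ∀ r x y : ℝ,
      eval (r • a + x • b + y • c) l = r * eval a l + x * eval b l + y * eval c l) ∧
    ∀ a, dirD a l = C (eval a l) := by
  rw [homogeneousSubmodule_one_eq_span_X] at hl
  induction hl using Submodule.span_induction with
  | mem l h =>
    obtain ⟨i, rfl⟩ := h
    simp [dirD]
  | zero => simp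
  | add f g _ _ hf hg =>
    refine ⟨fun a b c r x y => ?_, fun a => ?_⟩
    · rw [map_add, hf.1, hg.1]
      simp only [map_add]
      ring
    · simp [hf.2, hg.2]
  | smul t f _ hf =>
    refine ⟨fun a b c r x y => ?_, fun a => ?_⟩
    · rw [smul_eval, hf.1]
      simp only [smul_eval]
      ring
    · rw [Derivation.map_smul, hf.2, smul_eval, smul_eq_C_mul, C_mul]

/-- Taylor expansion of a quadratic form. -/
lemma isHomogeneous_two_expansion {q : MvP} (hq : q.IsHomogeneous 2) (a b c : Fin 3 → ℝ)
    (r x y : ℝ) :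
    eval (r • a + x • b + y • c) q = r ^ 2 * eval a q +
      r * (x * eval a (dirD b q) + y * eval a (dirD c q)) +
      (x ^ 2 * (eval a (dirD b (dirD b q)) / 2) + x * y * eval a (dirD c (dirD b q)) +
        y ^ 2 * (eval a (dirD c (dirD c q)) / 2)) := by
  have hq' : q ∈ homogeneousSubmodule (Fin 3) ℝ 1 * homogeneousSubmodule (Fin 3) ℝ 1 := by
    rwa [← pow_two, homogeneousSubmodule_one_pow, mem_homogeneousSubmodule]
  induction hq' using Submodule.mul_induction_on' with
  | mem_mul_mem l hl l' hl' =>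
    have h := isHomogeneous_one_expansion hl
    have h' := isHomogeneous_one_expansion hl'
    simp only [map_mul, Derivation.leibniz, smul_eq_mul, map_add, h.1, h'.1, h.2, h'.2, eval_C,
      derivation_C, mul_zero, map_zero]
    ring
  | add f hf g hg ihf ihg =>
    have key : ∀ f ∈ homogeneousSubmodule (Fin 3) ℝ 1 * homogeneousSubmodule (Fin 3) ℝ 1,
        f.IsHomogeneous 2 := fun f hf => by
      rwa [← pow_two, homogeneousSubmodule_one_pow, mem_homogeneousSubmodule] at hf
    simp only [map_add, ihf (key f hf), ihg (key g hg)]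
    ring

/-- Taylor expansion of a quartic form, with explicit coefficients up to second order. -/
lemma isHomogeneous_four_expansion {g : MvP} (hg : g.IsHomogeneous 4) (a b c : Fin 3 → ℝ) :
    ∃ k : Fin 9 → ℝ, ∀ r x y : ℝ,
    eval (r • a + x • b + y • c) g = r ^ 4 * eval a g +
      r ^ 3 * (x * eval a (dirD b g) + y * eval a (dirD c g)) +
      r ^ 2 * (x ^ 2 * (eval a (dirD b (dirD b g)) / 2) + x * y * eval a (dirD c (dirD b g)) +
        y ^ 2 * (eval a (dirD c (dirD c g)) / 2)) +
      r * (x ^ 3 * k 0 + x ^ 2 * y * k 1 + x * y ^ 2 * k 2 + y ^ 3 * k 3) +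
      (x ^ 4 * k 4 + x ^ 3 * y * k 5 + x ^ 2 * y ^ 2 * k 6 + x * y ^ 3 * k 7 + y ^ 4 * k 8) := by
  have hg' : g ∈ homogeneousSubmodule (Fin 3) ℝ 2 * homogeneousSubmodule (Fin 3) ℝ 2 := by
    rw [← homogeneousSubmodule_one_pow, ← pow_add, homogeneousSubmodule_one_pow]
    exact hg
  clear hg
  induction hg' using Submodule.mul_induction_on' with
  | mem_mul_mem q hq q' hq' =>
    refine ⟨![
      eval a (dirD b q) * (eval a (dirD b (dirD b q')) / 2) +
        eval a (dirD b q') * (eval a (dirD b (dirD b q)) / 2),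
      eval a (dirD b q) * eval a (dirD c (dirD b q')) +
        eval a (dirD b q') * eval a (dirD c (dirD b q)) +
        eval a (dirD c q) * (eval a (dirD b (dirD b q')) / 2) +
        eval a (dirD c q') * (eval a (dirD b (dirD b q)) / 2),
      eval a (dirD c q) * eval a (dirD c (dirD b q')) +
        eval a (dirD c q') * eval a (dirD c (dirD b q)) +
        eval a (dirD b q) * (eval a (dirD c (dirD c q')) / 2) +
        eval a (dirD b q') * (eval a (dirD c (dirD c q)) / 2),
      eval a (dirD c q) * (eval a (dirD c (dirD c q')) / 2) +
        eval a (dirD c q') * (eval a (dirD c (dirD c q)) / 2),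
      (eval a (dirD b (dirD b q)) / 2) * (eval a (dirD b (dirD b q')) / 2),
      (eval a (dirD b (dirD b q)) / 2) * eval a (dirD c (dirD b q')) +
        (eval a (dirD b (dirD b q')) / 2) * eval a (dirD c (dirD b q)),
      (eval a (dirD b (dirD b q)) / 2) * (eval a (dirD c (dirD c q')) / 2) +
        (eval a (dirD b (dirD b q')) / 2) * (eval a (dirD c (dirD c q)) / 2) +
        eval a (dirD c (dirD b q)) * eval a (dirD c (dirD b q')),
      (eval a (dirD c (dirD c q)) / 2) * eval a (dirD c (dirD b q')) +
        (eval a (dirD c (dirD c q')) / 2) * eval a (dirD c (dirD b q)),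
      (eval a (dirD c (dirD c q)) / 2) * (eval a (dirD c (dirD c q')) / 2)], fun r x y => ?_⟩
    simp only [map_mul, isHomogeneous_two_expansion hq a b c, isHomogeneous_two_expansion hq' a b c,
      Derivation.leibniz, smul_eq_mul, map_add]
    simp
    ring
  | add f hf g hg ihf ihg =>
    obtain ⟨k, hk⟩ := ihf
    obtain ⟨k', hk'⟩ := ihg
    refine ⟨k + k', fun r x y => ?_⟩
    simp only [map_add, hk, hk', Pi.add_apply]
    ring

lemma eval_lineP (p v : Fin 3 → ℝ) (f : MvP) (t : ℝ) :
    (lineP p v f).eval t = eval (p + t • v) f := by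
  induction f using MvPolynomial.induction_on with
  | C a => simp [lineP]
  | add f g hf hg =>
    rw [map_add, ← hf, ← hg, lineP, map_add, Polynomial.eval_add]
    rfl
  | mul_X f i hf =>
    rw [map_mul, ← hf, lineP, map_mul, Polynomial.eval_mul, aeval_X]
    simp [lineP, mul_comm t]

lemma lineP_add (p v : Fin 3 → ℝ) (f g : MvP) : lineP p v (f + g) = lineP p v f + lineP p v g :=
  map_add _ _ _

lemma lineP_smul (p v : Fin 3 → ℝ) (c : ℝ) (f : MvP) : lineP p v (c • f) = c • lineP p v f :=
  map_smul _ _ _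

lemma coeff_of_eval_eq {P : Polynomial ℝ} {c₀ c₁ c₂ c₃ c₄ : ℝ}
    (h : ∀ t, P.eval t = c₀ + c₁ * t + c₂ * t ^ 2 + c₃ * t ^ 3 + c₄ * t ^ 4) :
    P.coeff 2 = c₂ ∧ P.coeff 3 = c₃ := by
  have hP : P = Polynomial.C c₀ + Polynomial.C c₁ * Polynomial.X +
      Polynomial.C c₂ * Polynomial.X ^ 2 + Polynomial.C c₃ * Polynomial.X ^ 3 +
      Polynomial.C c₄ * Polynomial.X ^ 4 :=
    Polynomial.funext fun t => by rw [h t]; simp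
  rw [hP]
  constructor <;> simp

lemma coeff_two_lineP {g : MvP} (hg : g.IsHomogeneous 4) (p v : Fin 3 → ℝ) :
    (lineP p v g).coeff 2 = eval p (dirD v (dirD v g)) / 2 := by
  obtain ⟨k, hk⟩ := isHomogeneous_four_expansion hg p v 0
  refine (coeff_of_eval_eq (c₀ := eval p g) (c₁ := eval p (dirD v g)) (c₃ := k 0) (c₄ := k 4)
    fun t => ?_).1
  have := hk 1 t 0
  rw [eval_lineP]
  simp only [one_smul, smul_zero, add_zero] at this
  rw [this]
  ring

lemma coeff_three_lineP {g : MvP} (p v c : Fin 3 → ℝ) {k : Fin 9 → ℝ}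
    (hk : ∀ r x y : ℝ,
    eval (r • p + x • v + y • c) g = r ^ 4 * eval p g +
      r ^ 3 * (x * eval p (dirD v g) + y * eval p (dirD c g)) +
      r ^ 2 * (x ^ 2 * (eval p (dirD v (dirD v g)) / 2) + x * y * eval p (dirD c (dirD v g)) +
        y ^ 2 * (eval p (dirD c (dirD c g)) / 2)) +
      r * (x ^ 3 * k 0 + x ^ 2 * y * k 1 + x * y ^ 2 * k 2 + y ^ 3 * k 3) +
      (x ^ 4 * k 4 + x ^ 3 * y * k 5 + x ^ 2 * y ^ 2 * k 6 + x * y ^ 3 * k 7 + y ^ 4 * k 8)) :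
    (lineP p v g).coeff 3 = k 0 := by
  refine (coeff_of_eval_eq (c₀ := eval p g) (c₁ := eval p (dirD v g))
    (c₂ := eval p (dirD v (dirD v g)) / 2) (c₄ := k 4) fun t => ?_).2
  have := hk 1 t 0
  rw [eval_lineP]
  simp only [one_smul, zero_smul, add_zero] at this
  rw [this]
  ring

lemma nonneg_at_zero_of_continuous {h : ℝ → ℝ} (hc : Continuous h) (hp : ∀ t, 0 < t → 0 ≤ h t) :
    0 ≤ h 0 := by
  refine ge_of_tendsto ((hc.tendsto 0).mono_left (nhdsWithin_le_nhds (s := Set.Ioi 0))) ?_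
  filter_upwards [self_mem_nhdsWithin] with t ht using hp t ht

lemma lowest_coeff_nonneg {a b c d : ℝ} (h : ∀ t, 0 ≤ t * (a + b * t + c * t ^ 2 + d * t ^ 3)) :
    a = 0 := by
  have h₁ : 0 ≤ a := by
    simpa using nonneg_at_zero_of_continuous (h := fun t => a + b * t + c * t ^ 2 + d * t ^ 3)
      (by fun_prop) fun t ht => nonneg_of_mul_nonneg_right (h t) ht
  have h₂ : 0 ≤ -a := by
    have := nonneg_at_zero_of_continuous
      (h := fun t => -(a + b * (-t) + c * (-t) ^ 2 + d * (-t) ^ 3)) (by fun_prop) fun t ht =>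
        nonneg_of_mul_nonneg_right (by linarith [h (-t)]) ht
    norm_num at this
    linarith
  linarith

lemma quartic_nonneg {a b c d : ℝ} (h : ∀ t, 0 ≤ a * t + b * t ^ 2 + c * t ^ 3 + d * t ^ 4) :
    a = 0 ∧ 0 ≤ b ∧ (b = 0 → c = 0) := by
  have ha : a = 0 := lowest_coeff_nonneg (b := b) (c := c) (d := d) fun t => by linarith [h t]
  subst ha
  have h' : ∀ t, t ≠ 0 → 0 ≤ b + c * t + d * t ^ 2 := fun t ht =>
    nonneg_of_mul_nonneg_right (by linarith [h t]) (by positivity : 0 < t ^ 2)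
  refine ⟨rfl, ?_, fun hb => ?_⟩
  · simpa using nonneg_at_zero_of_continuous (h := fun t => b + c * t + d * t ^ 2)
      (by fun_prop) fun t ht => h' t ht.ne'
  · subst hb
    refine lowest_coeff_nonneg (b := d) (c := 0) (d := 0) fun t => ?_
    rcases eq_or_ne t 0 with rfl | ht
    · simp
    · linarith [h' t ht]

lemma Pcone.eval_dirD_eq_zero {g : MvP} (hg : g ∈ Pcone) {p : Fin 3 → ℝ} (h : eval p g = 0)
    (u : Fin 3 → ℝ) : eval p (dirD u g) = 0 := by
  obtain ⟨k, hk⟩ := isHomogeneous_four_expansion hg.1 p u 0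
  refine (quartic_nonneg (b := eval p (dirD u (dirD u g)) / 2) (c := k 0) (d := k 4)
    fun t => ?_).1
  have := hg.2 ((1 : ℝ) • p + t • u + (0 : ℝ) • 0)
  rw [hk, h] at this
  linarith

lemma Pcone.coeff_two_lineP_nonneg {g : MvP} (hg : g ∈ Pcone) {p : Fin 3 → ℝ} (h : eval p g = 0)
    (u : Fin 3 → ℝ) : 0 ≤ (lineP p u g).coeff 2 := by
  rw [coeff_two_lineP hg.1]
  obtain ⟨k, hk⟩ := isHomogeneous_four_expansion hg.1 p u 0
  refine (quartic_nonneg (a := 0) (c := k 0) (d := k 4) fun t => ?_).2.1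
  have := hg.2 ((1 : ℝ) • p + t • u + (0 : ℝ) • 0)
  rw [hk, h, Pcone.eval_dirD_eq_zero hg h] at this
  linarith

lemma grad_eq_zero_iff {g : MvP} {p : Fin 3 → ℝ} :
    grad g p = 0 ↔ ∀ u, eval p (dirD u g) = 0 := by
  simp only [eval_dirD]
  exact ⟨fun h u => by simp [h], fun h => dotProduct_eq_zero _ h⟩

lemma hess_mulVec_eq_zero_iff {g : MvP} {p v : Fin 3 → ℝ} :
    (hess g p).mulVec v = 0 ↔ ∀ u, eval p (dirD u (dirD v g)) = 0 := by
  simp only [eval_dirD_dirD]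
  exact ⟨fun h u => by simp [h], fun h => dotProduct_eq_zero _ fun u => by
    rw [dotProduct_comm]; exact h u⟩

lemma Fp_subset_Ip (p : Fin 3 → ℝ) : Fp p ⊆ Ip p := fun _ hg =>
  ⟨hg.1.1, hg.2, grad_eq_zero_iff.2 (Pcone.eval_dirD_eq_zero hg.1 hg.2)⟩

lemma Fpv_subset_Ipv (p v : Fin 3 → ℝ) : Fpv p v ⊆ Ipv p v := by
  rintro g ⟨hg, h0, h2⟩
  have hD := Pcone.eval_dirD_eq_zero hg h0
  rw [coeff_two_lineP hg.1] at h2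
  refine ⟨hg.1, h0, grad_eq_zero_iff.2 hD, hess_mulVec_eq_zero_iff.2 fun w => ?_, ?_⟩
  · obtain ⟨k, hk⟩ := isHomogeneous_four_expansion hg.1 p v w
    set B := eval p (dirD w (dirD v g))
    set A := eval p (dirD w (dirD w g)) / 2
    have key : ∀ s : ℝ, 0 ≤ s * B + A := fun s => by
      refine (quartic_nonneg (a := 0)
        (c := s ^ 3 * k 0 + s ^ 2 * k 1 + s * k 2 + k 3)
        (d := s ^ 4 * k 4 + s ^ 3 * k 5 + s ^ 2 * k 6 + s * k 7 + k 8) fun t => ?_).2.1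
      have := hg.2 ((1 : ℝ) • p + (t * s) • v + t • w)
      rw [hk, h0, hD, hD, h2] at this
      linarith
    by_contra hB
    have := key (-(A + 1) / B)
    rw [div_mul_cancel₀ _ hB] at this
    linarith
  · obtain ⟨k, hk⟩ := isHomogeneous_four_expansion hg.1 p v 0
    rw [coeff_three_lineP p v 0 hk]
    refine (quartic_nonneg (a := 0) (b := 0) (d := k 4) fun t => ?_).2.2 rfl
    have := hg.2 ((1 : ℝ) • p + t • v + (0 : ℝ) • 0)
    rw [hk, h0, hD, h2] at this
    linarith

/-- `IS` as a linear subspace. -/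
def ISsub {n m : ℕ} (s : Fin n → Fin 3 → ℝ) (p v : Fin m → Fin 3 → ℝ) : Submodule ℝ MvP where
  carrier := IS s p v
  zero_mem' := by
    simp [IS, Ip, Ipv, grad_eq_zero_iff, hess_mulVec_eq_zero_iff, isHomogeneous_zero, lineP]
  add_mem' := by
    simp only [IS, Ip, Ipv, grad_eq_zero_iff, hess_mulVec_eq_zero_iff, Set.mem_inter_iff,
      Set.mem_iInter, Set.mem_ofPred_eq, map_add, lineP_add, Polynomial.coeff_add]
    rintro f g ⟨⟨hf, hf1⟩, hf2⟩ ⟨⟨hg, hg1⟩, hg2⟩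
    refine ⟨⟨hf.add hg, fun i => ⟨hf.add hg, ?_, fun u => ?_⟩⟩, fun j =>
      ⟨hf.add hg, ?_, fun u => ?_, fun u => ?_, ?_⟩⟩
    · rw [(hf1 i).2.1, (hg1 i).2.1, add_zero]
    · rw [(hf1 i).2.2, (hg1 i).2.2, add_zero]
    · rw [(hf2 j).2.1, (hg2 j).2.1, add_zero]
    · rw [(hf2 j).2.2.1, (hg2 j).2.2.1, add_zero]
    · rw [(hf2 j).2.2.2.1, (hg2 j).2.2.2.1, add_zero]
    · rw [(hf2 j).2.2.2.2, (hg2 j).2.2.2.2, add_zero]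
  smul_mem' := by
    simp only [IS, Ip, Ipv, grad_eq_zero_iff, hess_mulVec_eq_zero_iff, Set.mem_inter_iff,
      Set.mem_iInter, Set.mem_ofPred_eq, Derivation.map_smul, lineP_smul, Polynomial.coeff_smul,
      smul_eval, smul_eq_mul]
    rintro c f ⟨⟨hf, hf1⟩, hf2⟩
    have hcf : (c • f).IsHomogeneous 4 := (homogeneousSubmodule (Fin 3) ℝ 4).smul_mem c hf
    refine ⟨⟨hcf, fun i => ⟨hcf, ?_, fun u => ?_⟩⟩, fun j =>
      ⟨hcf, ?_, fun u => ?_, fun u => ?_, ?_⟩⟩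
    · rw [(hf1 i).2.1, mul_zero]
    · rw [(hf1 i).2.2, mul_zero]
    · rw [(hf2 j).2.1, mul_zero]
    · rw [(hf2 j).2.2.1, mul_zero]
    · rw [(hf2 j).2.2.2.1, mul_zero]
    · rw [(hf2 j).2.2.2.2, mul_zero]

lemma FS_subset_IS {n m : ℕ} (s : Fin n → Fin 3 → ℝ) (p v : Fin m → Fin 3 → ℝ) :
    FS s p v ⊆ IS s p v :=
  Set.inter_subset_inter (Set.inter_subset_inter (fun _ h => h.1)
    (Set.iInter_mono fun i => Fp_subset_Ip (s i)))
    (Set.iInter_mono fun j => Fpv_subset_Ipv (p j) (v j))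

lemma IS_inter_Pcone_subset_FS {n m : ℕ} (s : Fin n → Fin 3 → ℝ) (p v : Fin m → Fin 3 → ℝ) :
    IS s p v ∩ Pcone ⊆ FS s p v := by
  rintro g ⟨⟨⟨hg, h1⟩, h2⟩, hP⟩
  refine ⟨⟨hP, Set.mem_iInter.2 fun i => ⟨hP, (Set.mem_iInter.1 h1 i).2.1⟩⟩,
    Set.mem_iInter.2 fun j => ?_⟩
  have h := Set.mem_iInter.1 h2 j
  refine ⟨hP, h.2.1, ?_⟩
  rw [coeff_two_lineP hg, hess_mulVec_eq_zero_iff.1 h.2.2.2.1, zero_div]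

open Filter Topology in
/-- If `Q₁, Q₂` are linear in `X, Y` with an invertible continuous coefficient matrix, then locally
every quadratic form in `X, Y` with continuous coefficients is `O(Q₁² + Q₂²)`. -/
lemma exists_eventually_quadratic_le {α : Type*} [TopologicalSpace α] {a : α}
    {X Y m₁₁ m₁₂ m₂₁ m₂₂ g₁₁ g₁₂ g₂₂ : α → ℝ} (h₁₁ : Continuous m₁₁) (h₁₂ : Continuous m₁₂)
    (h₂₁ : Continuous m₂₁) (h₂₂ : Continuous m₂₂) (hg₁₁ : Continuous g₁₁) (hg₁₂ : Continuous g₁₂)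
    (hg₂₂ : Continuous g₂₂) (hdet : m₁₁ a * m₂₂ a - m₁₂ a * m₂₁ a ≠ 0) :
    ∃ C : ℝ, ∀ᶠ b in 𝓝 a, |g₁₁ b * X b ^ 2 + g₁₂ b * (X b * Y b) + g₂₂ b * Y b ^ 2| ≤
      C * ((m₁₁ b * X b + m₁₂ b * Y b) ^ 2 + (m₂₁ b * X b + m₂₂ b * Y b) ^ 2) := by
  set Δ : α → ℝ := fun b => m₁₁ b * m₂₂ b - m₁₂ b * m₂₁ b with hΔ
  have hΔc : Continuous Δ := by fun_prop
  set K : α → ℝ := fun b => (|g₁₁ b| + |g₁₂ b| + |g₂₂ b|) *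
    ((m₂₂ b / Δ b) ^ 2 + (m₁₂ b / Δ b) ^ 2 + (m₂₁ b / Δ b) ^ 2 + (m₁₁ b / Δ b) ^ 2) with hK
  have hKc : ContinuousAt K a := by
    have := hΔc.continuousAt (x := a)
    have hd : Δ a ≠ 0 := hdet
    refine ContinuousAt.mul (by fun_prop) ?_
    exact (((h₂₂.continuousAt.div this hd).pow 2).add ((h₁₂.continuousAt.div this hd).pow 2)).add
      ((h₂₁.continuousAt.div this hd).pow 2) |>.add ((h₁₁.continuousAt.div this hd).pow 2)
  refine ⟨K a + 1, ?_⟩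
  filter_upwards [hKc.eventually_lt (continuousAt_const (y := K a + 1)) (lt_add_one _),
    hΔc.continuousAt.eventually_ne hdet] with b hb hd
  refine le_trans ?_ (mul_le_mul_of_nonneg_right hb.le (by positivity))
  set Q₁ := m₁₁ b * X b + m₁₂ b * Y b with hQ₁
  set Q₂ := m₂₁ b * X b + m₂₂ b * Y b with hQ₂
  have hX : X b = m₂₂ b / Δ b * Q₁ - m₁₂ b / Δ b * Q₂ := by
    field_simp
    simp only [hQ₁, hQ₂, hΔ]
    ring
  have hY : Y b = m₁₁ b / Δ b * Q₂ - m₂₁ b / Δ b * Q₁ := by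
    field_simp
    simp only [hQ₁, hQ₂, hΔ]
    ring
  have hX2 : X b ^ 2 ≤ ((m₂₂ b / Δ b) ^ 2 + (m₁₂ b / Δ b) ^ 2) * (Q₁ ^ 2 + Q₂ ^ 2) := by
    rw [hX]
    linarith [sq_nonneg (m₂₂ b / Δ b * Q₂ + m₁₂ b / Δ b * Q₁)]
  have hY2 : Y b ^ 2 ≤ ((m₂₁ b / Δ b) ^ 2 + (m₁₁ b / Δ b) ^ 2) * (Q₁ ^ 2 + Q₂ ^ 2) := by
    rw [hY]
    linarith [sq_nonneg (m₂₁ b / Δ b * Q₂ + m₁₁ b / Δ b * Q₁)]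
  have hXY : |X b * Y b| ≤ X b ^ 2 + Y b ^ 2 := by
    rw [abs_le]
    constructor <;> nlinarith [sq_nonneg (X b - Y b), sq_nonneg (X b + Y b), sq_nonneg (X b),
      sq_nonneg (Y b)]
  calc |g₁₁ b * X b ^ 2 + g₁₂ b * (X b * Y b) + g₂₂ b * Y b ^ 2|
      ≤ |g₁₁ b| * X b ^ 2 + |g₁₂ b| * |X b * Y b| + |g₂₂ b| * Y b ^ 2 := by
        refine (abs_add_three _ _ _).trans_eq ?_
        rw [abs_mul, abs_mul (g₁₂ b), abs_mul (g₂₂ b), abs_sq, abs_sq]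
    _ ≤ |g₁₁ b| * (X b ^ 2 + Y b ^ 2) + |g₁₂ b| * (X b ^ 2 + Y b ^ 2) +
          |g₂₂ b| * (X b ^ 2 + Y b ^ 2) := by
        gcongr
        · linarith [sq_nonneg (Y b)]
        · linarith [sq_nonneg (X b)]
    _ = (|g₁₁ b| + |g₁₂ b| + |g₂₂ b|) * (X b ^ 2 + Y b ^ 2) := by ring
    _ ≤ (|g₁₁ b| + |g₁₂ b| + |g₂₂ b|) *
          (((m₂₂ b / Δ b) ^ 2 + (m₁₂ b / Δ b) ^ 2) * (Q₁ ^ 2 + Q₂ ^ 2) +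
            ((m₂₁ b / Δ b) ^ 2 + (m₁₁ b / Δ b) ^ 2) * (Q₁ ^ 2 + Q₂ ^ 2)) := by gcongr
    _ = K b * (Q₁ ^ 2 + Q₂ ^ 2) := by simp only [hK]; ring

lemma exists_coordinates {a b c : Fin 3 → ℝ} (h : LinearIndependent ℝ ![a, b, c]) :
    ∃ r x y : (Fin 3 → ℝ) → ℝ, Continuous r ∧ Continuous x ∧ Continuous y ∧
      (∀ u, u = r u • a + x u • b + y u • c) ∧
      ∀ t : ℝ, r (t • a) = t ∧ x (t • a) = 0 ∧ y (t • a) = 0 := by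
  set B := basisOfLinearIndependentOfCardEqFinrank h (by simp) with hB
  have h0 : B 0 = a := by simp [hB]
  refine ⟨B.coord 0, B.coord 1, B.coord 2, LinearMap.continuous_of_finiteDimensional _,
    LinearMap.continuous_of_finiteDimensional _, LinearMap.continuous_of_finiteDimensional _,
    fun u => ?_, fun t => ?_⟩
  · conv_lhs => rw [← B.sum_repr u, Fin.sum_univ_three]
    simp [hB]
  · rw [← h0]
    simp

lemma eval_dirD_self {q : MvP} (hq : q.IsHomogeneous 2) (a : Fin 3 → ℝ) :
    eval a (dirD a q) = 2 * eval a q := by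
  have h₁ := isHomogeneous_two_expansion hq a a 0 1 1 0
  have h₂ := isHomogeneous_two_expansion hq a a 0 0 1 0
  have h₃ := isHomogeneous_two_expansion hq a a 0 2 0 0
  rw [show (1 : ℝ) • a + (1 : ℝ) • a + (0 : ℝ) • (0 : Fin 3 → ℝ) =
    (2 : ℝ) • a + (0 : ℝ) • a + (0 : ℝ) • (0 : Fin 3 → ℝ) by module] at h₁
  rw [show (0 : ℝ) • a + (1 : ℝ) • a + (0 : ℝ) • (0 : Fin 3 → ℝ) = a by module] at h₂
  linarith

lemma gram_ne_zero {A B : Fin 3 → ℝ} (h : LinearIndependent ℝ ![A, B]) :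
    (A ⬝ᵥ A) * (B ⬝ᵥ B) - (A ⬝ᵥ B) * (B ⬝ᵥ A) ≠ 0 := by
  intro h0
  have hB : B ≠ 0 := h.ne_zero 1
  have hz : (B ⬝ᵥ B) • A + (-(A ⬝ᵥ B)) • B = 0 := by
    rw [← dotProduct_self_eq_zero]
    simp only [add_dotProduct, dotProduct_add, smul_dotProduct, dotProduct_smul, smul_eq_mul]
    rw [dotProduct_comm B A] at h0 ⊢
    linear_combination (B ⬝ᵥ B) * h0
  have := (LinearIndependent.pair_iff.1 h _ _ hz).1
  exact hB (dotProduct_self_eq_zero.1 this)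

lemma linearIndependent_of_orthogonal {s A B : Fin 3 → ℝ} (hs : s ≠ 0) (hA : A ⬝ᵥ s = 0)
    (hB : B ⬝ᵥ s = 0) (h : LinearIndependent ℝ ![A, B]) : LinearIndependent ℝ ![s, A, B] := by
  refine linearIndependent_finCons.2 ⟨h, fun hmem => hs ?_⟩
  rw [Matrix.range_cons, Matrix.range_cons, Matrix.range_empty, Set.union_empty,
    Set.singleton_union, Submodule.mem_span_pair] at hmem
  obtain ⟨x, y, hxy⟩ := hmem
  rw [← dotProduct_self_eq_zero]
  nth_rw 1 [← hxy]
  simp [add_dotProduct, hA, hB]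

open Filter Topology

lemma exists_eventually_le_of_simple_zero {g Q₁ Q₂ : MvP} {s : Fin 3 → ℝ} (hs : s ≠ 0)
    (hg : g ∈ Ip s) (hQ₁ : Q₁.IsHomogeneous 2) (hQ₂ : Q₂.IsHomogeneous 2) (h₁ : eval s Q₁ = 0)
    (h₂ : eval s Q₂ = 0) (h : LinearIndependent ℝ ![grad Q₁ s, grad Q₂ s]) {t : ℝ} (ht : t ≠ 0) :
    ∃ C : ℝ, ∀ᶠ b in 𝓝 (t • s), |eval b g| ≤ C * (eval b Q₁ ^ 2 + eval b Q₂ ^ 2) := by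
  have hA : grad Q₁ s ⬝ᵥ s = 0 := by rw [← eval_dirD, eval_dirD_self hQ₁, h₁, mul_zero]
  have hB : grad Q₂ s ⬝ᵥ s = 0 := by rw [← eval_dirD, eval_dirD_self hQ₂, h₂, mul_zero]
  have hdet := gram_ne_zero h
  obtain ⟨r, x, y, hr, hx, hy, hu, ht'⟩ :=
    exists_coordinates (linearIndependent_of_orthogonal hs hA hB h)
  set A := grad Q₁ s
  set B := grad Q₂ s
  obtain ⟨hg4, hg0, hg1⟩ := hg
  rw [grad_eq_zero_iff] at hg1
  obtain ⟨k, hk⟩ := isHomogeneous_four_expansion hg4 s A B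
  obtain ⟨C, hC⟩ := exists_eventually_quadratic_le (a := t • s) (X := x) (Y := y)
    (m₁₁ := fun b => r b * (A ⬝ᵥ A) + x b * (eval s (dirD A (dirD A Q₁)) / 2))
    (m₁₂ := fun b => r b * (A ⬝ᵥ B) + x b * eval s (dirD B (dirD A Q₁)) +
      y b * (eval s (dirD B (dirD B Q₁)) / 2))
    (m₂₁ := fun b => r b * (B ⬝ᵥ A) + x b * (eval s (dirD A (dirD A Q₂)) / 2))
    (m₂₂ := fun b => r b * (B ⬝ᵥ B) + x b * eval s (dirD B (dirD A Q₂)) +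
      y b * (eval s (dirD B (dirD B Q₂)) / 2))
    (g₁₁ := fun b => r b ^ 2 * (eval s (dirD A (dirD A g)) / 2) + r b * x b * k 0 +
      r b * y b * k 1 + x b ^ 2 * k 4 + x b * y b * k 5 + y b ^ 2 * k 6)
    (g₁₂ := fun b => r b ^ 2 * eval s (dirD B (dirD A g)))
    (g₂₂ := fun b => r b ^ 2 * (eval s (dirD B (dirD B g)) / 2) + r b * x b * k 2 +
      r b * y b * k 3 + x b * y b * k 7 + y b ^ 2 * k 8)
    (by fun_prop) (by fun_prop) (by fun_prop) (by fun_prop) (by fun_prop) (by fun_prop)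
    (by fun_prop) (by
      simp only [(ht' t).1, (ht' t).2.1, (ht' t).2.2, zero_mul, add_zero]
      intro h0
      refine mul_ne_zero (pow_ne_zero 2 ht) hdet ?_
      linear_combination h0)
  refine ⟨C, hC.mono fun b hb => ?_⟩
  rw [hu b, hk, isHomogeneous_two_expansion hQ₁, isHomogeneous_two_expansion hQ₂, hg0, hg1, hg1,
    h₁, h₂]
  simp only [eval_dirD _ _ Q₁, eval_dirD _ _ Q₂]
  convert hb using 2
  · ring
  · ring

lemma exists_eventually_le_of_double_zero {g Q₁ Q₂ : MvP} {p v : Fin 3 → ℝ} (hp : p ≠ 0)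
    (hv : ∀ c : ℝ, v ≠ c • p) (hg : g ∈ Ipv p v) (hQ₁ : Q₁.IsHomogeneous 2)
    (hQ₂ : Q₂.IsHomogeneous 2) (h₁ : eval p Q₁ = 0) (h₁v : eval p (dirD v Q₁) = 0)
    (h₁g : grad Q₁ p ≠ 0) (h₂ : eval p Q₂ = 0) (h₂g : grad Q₂ p = 0) (h₂v : eval v Q₂ ≠ 0)
    {t : ℝ} (ht : t ≠ 0) :
    ∃ C : ℝ, ∀ᶠ b in 𝓝 (t • p), |eval b g| ≤ C * (eval b Q₁ ^ 2 + eval b Q₂ ^ 2) := by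
  have hpv : LinearIndependent ℝ ![p, v] := by
    refine (LinearIndependent.pair_iff' hp).2 fun c hc => hv c hc.symm
  obtain ⟨w, hw⟩ := exists_linearIndependent_snoc_of_lt_finrank hpv (by simp)
  rw [show Fin.snoc ![p, v] w = ![p, v, w] by simp] at hw
  obtain ⟨r, x, y, hr, hx, hy, hu, ht'⟩ := exists_coordinates hw
  have hα : eval p (dirD w Q₁) ≠ 0 := by
    intro h0
    refine h₁g (dotProduct_eq_zero _ fun u => ?_)
    have hp0 := eval_dirD_self hQ₁ p
    rw [h₁, mul_zero] at hp0
    rw [eval_dirD] at h0 hp0 h₁v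
    rw [hu u]
    simp [dotProduct_add, h0, hp0, h₁v]
  rw [grad_eq_zero_iff] at h₂g
  have hβ : eval p (dirD v (dirD v Q₂)) / 2 = eval v Q₂ := by
    have := isHomogeneous_two_expansion hQ₂ p v w 0 1 0
    rw [show (0 : ℝ) • p + (1 : ℝ) • v + (0 : ℝ) • w = v by module] at this
    linarith
  obtain ⟨hg4, hg0, hg1, hg2, hg3⟩ := hg
  rw [grad_eq_zero_iff] at hg1
  rw [hess_mulVec_eq_zero_iff] at hg2
  obtain ⟨k, hk⟩ := isHomogeneous_four_expansion hg4 p v w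
  rw [coeff_three_lineP p v w hk] at hg3
  obtain ⟨C, hC⟩ := exists_eventually_quadratic_le (a := t • p) (X := fun b => x b ^ 2) (Y := y)
    (m₁₁ := fun b => eval p (dirD v (dirD v Q₁)) / 2)
    (m₁₂ := fun b => r b * eval p (dirD w Q₁) + x b * eval p (dirD w (dirD v Q₁)) +
      y b * (eval p (dirD w (dirD w Q₁)) / 2))
    (m₂₁ := fun b => eval v Q₂)
    (m₂₂ := fun b => x b * eval p (dirD w (dirD v Q₂)) + y b * (eval p (dirD w (dirD w Q₂)) / 2))
    (g₁₁ := fun b => k 4)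
    (g₁₂ := fun b => r b * k 1 + x b * k 5)
    (g₂₂ := fun b => r b ^ 2 * (eval p (dirD w (dirD w g)) / 2) + r b * x b * k 2 +
      r b * y b * k 3 + x b ^ 2 * k 6 + x b * y b * k 7 + y b ^ 2 * k 8)
    (by fun_prop) (by fun_prop) (by fun_prop) (by fun_prop) (by fun_prop) (by fun_prop)
    (by fun_prop) (by
      simp only [(ht' t).1, (ht' t).2.1, (ht' t).2.2, zero_mul, add_zero, mul_zero, zero_sub]
      exact neg_ne_zero.2 (mul_ne_zero (mul_ne_zero ht hα) h₂v))
  refine ⟨C, hC.mono fun b hb => ?_⟩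
  rw [hu b, hk, isHomogeneous_two_expansion hQ₁, isHomogeneous_two_expansion hQ₂, hg0, hg1, hg1,
    hg2, hg2, hg3, h₁, h₂, h₁v, h₂g, h₂g, hβ]
  convert hb using 2
  · ring
  · ring

lemma exists_eventually_le_of_eval_ne_zero (g : MvP) {Q : MvP} {a : Fin 3 → ℝ}
    (h : eval a Q ≠ 0) : ∃ C : ℝ, ∀ᶠ b in 𝓝 a, |eval b g| ≤ C * (eval b Q ^ 2 + eval b Q ^ 2) := by
  have hQ : Continuous fun b => eval b Q := MvPolynomial.continuous_eval Q
  have hg : Continuous fun b => eval b g := MvPolynomial.continuous_eval g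
  have hpos : 0 < eval a Q ^ 2 := by positivity
  refine ⟨|eval a g| / eval a Q ^ 2 + 1, ?_⟩
  refine (ContinuousAt.eventually_lt (f := fun b => |eval b g|)
    (g := fun b => (|eval a g| / eval a Q ^ 2 + 1) * (eval b Q ^ 2 + eval b Q ^ 2))
    (by fun_prop) (by fun_prop) ?_).mono fun b hb => hb.le
  have : (|eval a g| / eval a Q ^ 2 + 1) * (eval a Q ^ 2 + eval a Q ^ 2) =
      2 * |eval a g| + 2 * eval a Q ^ 2 := by
    field_simp
    ring
  simp only [this]
  linarith [abs_nonneg (eval a g)]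

lemma sq_eval_le_of_mem_span {k : ℕ} {q : Fin k → MvP} {Q : MvP}
    (hQ : Q ∈ Submodule.span ℝ (Set.range q)) :
    ∃ C : ℝ, ∀ b, eval b Q ^ 2 ≤ C * eval b (∑ i, q i ^ 2) := by
  obtain ⟨c, rfl⟩ := (Submodule.mem_span_range_iff_exists_fun ℝ).1 hQ
  refine ⟨∑ i, c i ^ 2, fun b => ?_⟩
  simpa [smul_eval] using Finset.sum_mul_sq_le_sq_mul_sq Finset.univ c fun i => eval b (q i)

lemma eval_sum_sq_nonneg {k : ℕ} (q : Fin k → MvP) (b : Fin 3 → ℝ) :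
    0 ≤ eval b (∑ i, q i ^ 2) := by
  simp only [map_sum, map_pow]
  positivity

lemma isHomogeneous_four_eval_smul {g : MvP} (hg : g.IsHomogeneous 4) (t : ℝ) (a : Fin 3 → ℝ) :
    eval (t • a) g = t ^ 4 * eval a g := by
  obtain ⟨k, hk⟩ := isHomogeneous_four_expansion hg a 0 0
  simpa using hk t 0 0

/-- A local bound at every nonzero point yields a global bound, for quartic forms. -/
lemma exists_abs_eval_le {f g : MvP} (hf : f ∈ Pcone) (hg : g.IsHomogeneous 4)
    (h : ∀ a, a ≠ 0 → ∃ C : ℝ, ∀ᶠ b in 𝓝 a, |eval b g| ≤ C * eval b f) :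
    ∃ C : ℝ, 0 < C ∧ ∀ b, |eval b g| ≤ C * eval b f := by
  obtain ⟨C, hC⟩ : ∃ C : ℝ, ∀ b ∈ Metric.sphere (0 : Fin 3 → ℝ) 1, |eval b g| ≤ C * eval b f := by
    refine (isCompact_sphere (0 : Fin 3 → ℝ) 1).induction_on
      (p := fun t => ∃ C : ℝ, ∀ b ∈ t, |eval b g| ≤ C * eval b f) ⟨0, by simp⟩
      (fun s t hst ⟨C, hC⟩ => ⟨C, fun b hb => hC b (hst hb)⟩) ?_ fun a ha => ?_
    · rintro s t ⟨C, hC⟩ ⟨C', hC'⟩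
      refine ⟨max C C', fun b hb => ?_⟩
      have := hf.2 b
      rcases hb with hb | hb
      · exact (hC b hb).trans (mul_le_mul_of_nonneg_right (le_max_left _ _) this)
      · exact (hC' b hb).trans (mul_le_mul_of_nonneg_right (le_max_right _ _) this)
    · obtain ⟨C, hC⟩ := h a (ne_zero_of_mem_unit_sphere ⟨a, ha⟩)
      exact ⟨_, mem_nhdsWithin_of_mem_nhds hC, C, fun b hb => hb⟩
  refine ⟨max C 1, by positivity, fun b => ?_⟩
  refine le_trans ?_ (mul_le_mul_of_nonneg_right (le_max_left C 1) (hf.2 b))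
  rcases eq_or_ne b 0 with rfl | hb
  · have h0 := isHomogeneous_four_eval_smul hg 0 0
    have h0' := isHomogeneous_four_eval_smul hf.1 0 0
    simp only [smul_zero, ne_eq, OfNat.ofNat_ne_zero, not_false_eq_true, zero_pow, zero_mul]
      at h0 h0'
    rw [h0, h0', abs_zero, mul_zero]
  · have hn : ‖b‖ ≠ 0 := norm_ne_zero_iff.2 hb
    have := hC (‖b‖⁻¹ • b) (by simp [norm_smul, hn])
    have hb' : b = ‖b‖ • (‖b‖⁻¹ • b) := by rw [smul_smul, mul_inv_cancel₀ hn, one_smul]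
    rw [hb', isHomogeneous_four_eval_smul hg, isHomogeneous_four_eval_smul hf.1, abs_mul,
      abs_of_nonneg (by positivity : 0 ≤ ‖b‖ ^ 4)]
    calc _ ≤ ‖b‖ ^ 4 * (C * eval (‖b‖⁻¹ • b) f) := by gcongr
      _ = _ := by ring

lemma eval_dirD_eq_zero_of_sq_mem_Fpv {q : MvP} {p v : Fin 3 → ℝ} (h : q ^ 2 ∈ Fpv p v) :
    eval p q = 0 ∧ eval p (dirD v q) = 0 := by
  obtain ⟨hP, h0, h2⟩ := h
  have hq0 : eval p q = 0 := by simpa using h0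
  rw [coeff_two_lineP hP.1] at h2
  refine ⟨hq0, ?_⟩
  simpa [pow_two, Derivation.leibniz, hq0] using h2

/-- Theorem `algcon`: under the stated algebraic conditions on a subspace
`J ⊆ J_{F_S}`, we get `span(F_S) = I_S`; moreover for any basis `q₁,…,q_k` of `J` the
form `q₁² + ⋯ + q_k²` is an inner form of `F_S`, i.e. `F_{q₁²+⋯+q_k²} = F_S`. -/
theorem stmt_7 {n m : ℕ} (s : Fin n → Fin 3 → ℝ) (p v : Fin m → Fin 3 → ℝ)
    (hs0 : ∀ i, s i ≠ 0) (hp0 : ∀ j, p j ≠ 0)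
    (hss : ∀ i i', i ≠ i' → ∀ c : ℝ, s i ≠ c • s i')
    (hpp : ∀ j j', j ≠ j' → ∀ c : ℝ, p j ≠ c • p j')
    (hsp : ∀ i j, ∀ c : ℝ, s i ≠ c • p j)
    (hv : ∀ j, ∀ c : ℝ, v j ≠ c • p j)
    (J : Submodule ℝ MvP) (hJ : (J : Set MvP) ⊆ Jset (FS s p v))
    (h1 : ∀ a : Fin 3 → ℝ, a ≠ 0 → (∀ q ∈ J, eval a q = 0) →
      (∃ i, ∃ c : ℝ, a = c • s i) ∨ (∃ j, ∃ c : ℝ, a = c • p j))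
    (h2 : ∀ i, ∃ q ∈ J, ∃ q' ∈ J, LinearIndependent ℝ ![grad q (s i), grad q' (s i)])
    (h3 : ∀ j, ∃ q ∈ J, grad q (p j) ≠ 0)
    (h4 : ∀ j, ∀ a ∈ Submodule.span ℝ ({p j, v j} : Set (Fin 3 → ℝ)), a ≠ 0 →
      (∀ q ∈ J, grad q (p j) = 0 → eval a q = 0) → ∃ c : ℝ, a = c • p j) :
    (Submodule.span ℝ (FS s p v) : Set MvP) = IS s p v ∧
    ∀ (k : ℕ) (q : Fin k → MvP), (∀ i, q i ∈ J) →
      Submodule.span ℝ (Set.range q) = J → LinearIndependent ℝ q →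
      Fface (∑ i, q i ^ 2) = FS s p v := by
  have hJ2 : ∀ q ∈ J, q.IsHomogeneous 2 := fun q hq => (hJ hq).1
  have hJs : ∀ q ∈ J, ∀ i, eval (s i) q = 0 := fun q hq i => by
    simpa using (Set.mem_iInter.1 (hJ hq).2.1.2 i).2
  have hJp : ∀ q ∈ J, ∀ j, eval (p j) q = 0 ∧ eval (p j) (dirD (v j) q) = 0 := fun q hq j =>
    eval_dirD_eq_zero_of_sq_mem_Fpv (Set.mem_iInter.1 (hJ hq).2.2 j)
  have hlocal : ∀ g ∈ IS s p v, ∀ a, a ≠ 0 → ∃ Q₁ ∈ J, ∃ Q₂ ∈ J, ∃ C : ℝ,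
      ∀ᶠ b in 𝓝 a, |eval b g| ≤ C * (eval b Q₁ ^ 2 + eval b Q₂ ^ 2) := fun g hg a ha => by
    by_cases hz : ∀ q ∈ J, eval a q = 0
    · rcases h1 a ha hz with ⟨i, c, rfl⟩ | ⟨j, c, rfl⟩
      · obtain ⟨Q₁, hQ₁, Q₂, hQ₂, hli⟩ := h2 i
        exact ⟨Q₁, hQ₁, Q₂, hQ₂, exists_eventually_le_of_simple_zero (hs0 i)
          (Set.mem_iInter.1 hg.1.2 i) (hJ2 _ hQ₁) (hJ2 _ hQ₂) (hJs _ hQ₁ i) (hJs _ hQ₂ i) hli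
          (left_ne_zero_of_smul ha)⟩
      · obtain ⟨Q₁, hQ₁, hQ₁g⟩ := h3 j
        obtain ⟨Q₂, hQ₂, hQ₂g, hQ₂v⟩ : ∃ q ∈ J, grad q (p j) = 0 ∧ eval (v j) q ≠ 0 := by
          by_contra! hcon
          obtain ⟨c, hc⟩ := h4 j (v j) (Submodule.subset_span (by simp))
            (by simpa using hv j 0) hcon
          exact hv j c hc
        exact ⟨Q₁, hQ₁, Q₂, hQ₂, exists_eventually_le_of_double_zero (hp0 j) (hv j)
          (Set.mem_iInter.1 hg.2 j) (hJ2 _ hQ₁) (hJ2 _ hQ₂) (hJp _ hQ₁ j).1 (hJp _ hQ₁ j).2 hQ₁g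
          (hJp _ hQ₂ j).1 hQ₂g hQ₂v (left_ne_zero_of_smul ha)⟩
    · push Not at hz
      obtain ⟨Q, hQ, hQa⟩ := hz
      exact ⟨Q, hQ, Q, hQ, exists_eventually_le_of_eval_ne_zero g hQa⟩
  have hsum : ∀ (k : ℕ) (q : Fin k → MvP), (∀ i, q i ∈ J) → ∑ i, q i ^ 2 ∈ FS s p v :=
    fun k q hq => IS_inter_Pcone_subset_FS s p v
      ⟨(ISsub s p v).sum_mem fun i _ => FS_subset_IS s p v (hJ (hq i)).2,
        IsHomogeneous.sum _ _ _ fun i _ => (hJ2 _ (hq i)).pow 2, eval_sum_sq_nonneg q⟩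
  have hglobal : ∀ (k : ℕ) (q : Fin k → MvP), (∀ i, q i ∈ J) →
      Submodule.span ℝ (Set.range q) = J → ∀ g ∈ IS s p v,
      ∃ C : ℝ, 0 < C ∧ ∀ b, |eval b g| ≤ C * eval b (∑ i, q i ^ 2) := fun k q hq hspan g hg => by
    refine exists_abs_eval_le (hsum k q hq).1.1 hg.1.1 fun a ha => ?_
    obtain ⟨Q₁, hQ₁, Q₂, hQ₂, C, hC⟩ := hlocal g hg a ha
    obtain ⟨C₁, hC₁⟩ := sq_eval_le_of_mem_span (hspan ▸ hQ₁)
    obtain ⟨C₂, hC₂⟩ := sq_eval_le_of_mem_span (hspan ▸ hQ₂)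
    refine ⟨|C| * (C₁ + C₂), hC.mono fun b hb => hb.trans ?_⟩
    calc C * (eval b Q₁ ^ 2 + eval b Q₂ ^ 2)
        ≤ |C| * (eval b Q₁ ^ 2 + eval b Q₂ ^ 2) := by gcongr; exact le_abs_self C
      _ ≤ |C| * (C₁ * eval b (∑ i, q i ^ 2) + C₂ * eval b (∑ i, q i ^ 2)) := by
          gcongr
          · exact hC₁ b
          · exact hC₂ b
      _ = _ := by ring
  refine ⟨subset_antisymm ?_ fun g hg => ?_, fun k q hq hspan _ => subset_antisymm ?_ ?_⟩
  · exact Submodule.span_le (p := ISsub s p v).2 (FS_subset_IS s p v)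
  · have hfg : J.FG := by
      have : IsNoetherian ℝ (homogeneousSubmodule (Fin 3) ℝ 2) :=
        isNoetherian_of_fg_of_noetherian _ (homogeneousSubmodule_fg (Fin 3) ℝ 2)
      have hle : J ≤ homogeneousSubmodule (Fin 3) ℝ 2 := hJ2
      exact (isNoetherian_submodule.1 this) J hle
    obtain ⟨k, q, hspan⟩ := Submodule.fg_iff_exists_fin_generating_family.1 hfg
    have hq : ∀ i, q i ∈ J := fun i => hspan ▸ Submodule.subset_span ⟨i, rfl⟩
    obtain ⟨C, hC0, hC⟩ := hglobal k q hq hspan g hg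
    have hf := hsum k q hq
    have hadd : g + C • ∑ i, q i ^ 2 ∈ ISsub s p v :=
      add_mem hg ((ISsub s p v).smul_mem C (FS_subset_IS s p v hf))
    have hmem : g + C • ∑ i, q i ^ 2 ∈ FS s p v := by
      refine IS_inter_Pcone_subset_FS s p v ⟨hadd, hadd.1.1, fun a => ?_⟩
      rw [map_add, smul_eval]
      linarith [neg_abs_le (eval a g), hC a]
    have hsub := sub_mem (Submodule.subset_span (R := ℝ) hmem)
      (Submodule.smul_mem _ C (Submodule.subset_span (R := ℝ) hf))
    rwa [add_sub_cancel_right] at hsub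
  · rintro g ⟨hg, ε, hε, hfg⟩
    obtain ⟨⟨-, hfs⟩, hfp⟩ := hsum k q hq
    set f := ∑ i, q i ^ 2
    have hzero : ∀ a, eval a f = 0 → eval a g = 0 := fun a ha => by
      have h₁ := hfg.2 a
      have h₂ := hg.2 a
      rw [map_sub, smul_eval, ha] at h₁
      nlinarith
    refine ⟨⟨hg, Set.mem_iInter.2 fun i => ⟨hg, hzero _ (Set.mem_iInter.1 hfs i).2⟩⟩,
      Set.mem_iInter.2 fun j => ?_⟩
    obtain ⟨-, hf0, hf2⟩ := Set.mem_iInter.1 hfp j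
    have hg0 := hzero _ hf0
    refine ⟨hg, hg0, ?_⟩
    have h₁ := Pcone.coeff_two_lineP_nonneg hg hg0 (v j)
    have h₂ := Pcone.coeff_two_lineP_nonneg hfg (p := p j)
      (by rw [map_sub, smul_eval, hf0, hg0, mul_zero, sub_zero]) (v j)
    rw [sub_eq_add_neg, ← neg_smul, lineP_add, lineP_smul, Polynomial.coeff_add,
      Polynomial.coeff_smul, hf2, smul_eq_mul] at h₂
    nlinarith
  · intro g hg
    obtain ⟨C, hC0, hC⟩ := hglobal k q hq hspan g (FS_subset_IS s p v hg)
    refine ⟨hg.1.1, C⁻¹, inv_pos.2 hC0, (hsum k q hq).1.1.1.sub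
      ((homogeneousSubmodule (Fin 3) ℝ 4).smul_mem _ hg.1.1.1), fun a => ?_⟩
    rw [map_sub, smul_eval, sub_nonneg, inv_mul_le_iff₀ hC0]
    exact (le_abs_self _).trans (hC a)
end
end
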